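/- arXiv:math/0508358 — 2 statements merged into one kernel-verified Lean document; each statement's English description precedes it below -/
import Mathlib

section
/- Let (R,m) → (S,n) be a flat local homomorphism of Noetherian local rings whose closed fiber S/mS is a Cohen-Macaulay ring. If T is a seed over R, then T ⊗_R S is a seed over S. -/
open IsLocalRing

universe u v w

/-- `x` is a system of parameters of the local ring `R`: a sequence of `dim R` elements
of the maximal ideal generating an ideal primary to the maximal ideal. -/
def IsSOP (R : Type*) [CommRing R] [IsLocalRing R] {n : ℕ} (x : Fin n → R) : Prop :=
  (n : WithBot ℕ∞) = ringKrullDim R ∧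
  (∀ i, x i ∈ maximalIdeal R) ∧
  (Ideal.span (Set.range x)).radical = maximalIdeal R

/-- The sequence `x` of elements of `R` is a regular sequence on the `R`-module `M`. -/
def IsRegSeq (R : Type*) [CommRing R] (M : Type*) [AddCommGroup M] [Module R M]
    {n : ℕ} (x : Fin n → R) : Prop :=
  RingTheory.Sequence.IsRegular M (List.ofFn x)

/-- `B` is a big Cohen-Macaulay algebra over the local ring `R`: some system of
parameters of `R` is a regular sequence on `B` (and in particular `mB ≠ B`). -/
def IsBigCM (R : Type*) [CommRing R] [IsLocalRing R]
    (B : Type*) [CommRing B] [Algebra R B] : Prop :=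
  (∃ (n : ℕ) (x : Fin n → R), IsSOP R x ∧ IsRegSeq R B x) ∧
  (maximalIdeal R).map (algebraMap R B) ≠ ⊤

/-- `B` is a balanced big Cohen-Macaulay algebra over the local ring `R`: every system of
parameters of `R` is a regular sequence on `B` (and in particular `mB ≠ B`). -/
def IsBalancedBigCM (R : Type*) [CommRing R] [IsLocalRing R]
    (B : Type*) [CommRing B] [Algebra R B] : Prop :=
  (∀ (n : ℕ) (x : Fin n → R), IsSOP R x → IsRegSeq R B x) ∧
  (maximalIdeal R).map (algebraMap R B) ≠ ⊤

/-- `S` is a seed over the local ring `R`: `S` admits an `R`-algebra homomorphism to some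
big Cohen-Macaulay `R`-algebra. -/
def IsSeed (R : Type u) [CommRing R] [IsLocalRing R]
    (S : Type v) [CommRing S] [Algebra R S] : Prop :=
  ∃ (B : Type (max u v)) (_ : CommRing B) (_ : Algebra R B),
    IsBigCM R B ∧ Nonempty (S →ₐ[R] B)

/-- A Noetherian local ring is Cohen-Macaulay iff every system of parameters is a regular
sequence on it. -/
def IsCohenMacaulayLocalRing (A : Type*) [CommRing A] [IsLocalRing A] : Prop :=
  ∀ (n : ℕ) (x : Fin n → A), IsSOP A x → IsRegSeq A A x

open RingTheory.Sequence TensorProduct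

theorem QuotSMulTop.map_injective_of_exact {A M N P : Type*} [CommRing A] [AddCommGroup M]
    [Module A M] [AddCommGroup N] [Module A N] [AddCommGroup P] [Module A P]
    {f : M →ₗ[A] N} {g : N →ₗ[A] P} (hf : Function.Injective f) (hfg : Function.Exact f g)
    {r : A} (hr : IsSMulRegular P r) : Function.Injective (QuotSMulTop.map r f) := by
  have h := QuotSMulTop.map_first_exact_on_four_term_exact_of_isSMulRegular_last
    ((LinearMap.exact_zero_iff_injective PUnit f).mpr hf) hfg hr
  rw [map_zero] at h
  exact (LinearMap.exact_zero_iff_injective _ _).mp h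

/-- A sequence that is weakly regular on both ends of a short exact sequence is weakly regular
on the middle term. -/
theorem RingTheory.Sequence.IsWeaklyRegular.of_exact {A M N P : Type*} [CommRing A]
    [AddCommGroup M] [Module A M] [AddCommGroup N] [Module A N] [AddCommGroup P] [Module A P]
    {f : M →ₗ[A] N} {g : N →ₗ[A] P} (hf : Function.Injective f) (hfg : Function.Exact f g)
    (hg : Function.Surjective g) {rs : List A} (hM : IsWeaklyRegular M rs)
    (hP : IsWeaklyRegular P rs) : IsWeaklyRegular N rs := by
  induction rs generalizing M N P with
  | nil => exact .nil A N
  | cons r rs ih =>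
    rw [isWeaklyRegular_cons_iff] at hM hP ⊢
    exact ⟨isSMulRegular_of_range_eq_ker hf hfg.linearMap_ker_eq.symm hM.1 hP.1,
      ih (QuotSMulTop.map_injective_of_exact hf hfg hP.1) (QuotSMulTop.map_exact r hfg hg)
        (QuotSMulTop.map_surjective r hg) hM.2 hP.2⟩

theorem RingTheory.Sequence.IsWeaklyRegular.finsupp {A M : Type*} [CommRing A] [AddCommGroup M]
    [Module A M] {rs : List A} (h : IsWeaklyRegular M rs) (ι : Type*) :
    IsWeaklyRegular (ι →₀ M) rs := by
  classical
  exact ((finsuppScalarRight A A M ι).isWeaklyRegular_congr rs).mp h.isWeaklyRegular_rTensor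

section BaseChange

variable {R S : Type*} [CommRing R] [IsLocalRing R] [CommRing S] [Algebra R S]

/-- A sequence weakly regular on the closed fiber `S / mS` is weakly regular on the base change of
any `R`-module killed by `m`. -/
theorem isWeaklyRegular_baseChange_of_isTorsionBySet {rs : List S}
    (h : IsWeaklyRegular (S ⧸ (maximalIdeal R).map (algebraMap R S)) rs)
    (M : Type*) [AddCommGroup M] [Module R M]
    (hM : Module.IsTorsionBySet R M (maximalIdeal R)) :
    IsWeaklyRegular (S ⊗[R] M) rs := by
  classical
  let _ : Module (ResidueField R) M := hM.module
  have : IsScalarTower R (ResidueField R) M := hM.isScalarTower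
  let e := (Module.Basis.ofVectorSpace (ResidueField R) M).repr.restrictScalars R
  let e' := (e.baseChange R S _ _).trans (finsuppRight R S S (ResidueField R) _)
  refine (e'.isWeaklyRegular_congr rs).mpr (IsWeaklyRegular.finsupp ?_ _)
  exact ((Ideal.qoutMapEquivTensorQout S (I := maximalIdeal R)).isWeaklyRegular_congr rs).mp h

theorem isWeaklyRegular_baseChange_of_pow_smul_top [Module.Flat R S] {rs : List S}
    (h : IsWeaklyRegular (S ⧸ (maximalIdeal R).map (algebraMap R S)) rs) (n : ℕ)
    (M : Type*) [AddCommGroup M] [Module R M]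
    (hM : maximalIdeal R ^ n • (⊤ : Submodule R M) = ⊥) :
    IsWeaklyRegular (S ⊗[R] M) rs := by
  induction n generalizing M with
  | zero =>
    have : Subsingleton M := by
      rw [pow_zero, Ideal.one_eq_top, Submodule.top_smul] at hM
      exact (Submodule.subsingleton_iff R).mp (subsingleton_of_bot_eq_top hM.symm)
    exact isWeaklyRegular_baseChange_of_isTorsionBySet h M fun _ _ => Subsingleton.elim _ _
  | succ n ih =>
    let N : Submodule R M := maximalIdeal R • ⊤
    have hN : maximalIdeal R ^ n • (⊤ : Submodule R N) = ⊥ := by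
      apply Submodule.map_injective_of_injective N.injective_subtype
      rw [Submodule.map_smul'', Submodule.map_subtype_top, Submodule.map_bot, ← mul_smul,
        ← pow_succ, hM]
    have hQ : Module.IsTorsionBySet R (M ⧸ N) (maximalIdeal R) :=
      Module.isTorsionBySet_quotient_ideal_smul M (maximalIdeal R)
    exact IsWeaklyRegular.of_exact (f := N.subtype.baseChange S) (g := N.mkQ.baseChange S)
      (Module.Flat.lTensor_preserves_injective_linearMap _ N.injective_subtype)
      (lTensor_exact S (LinearMap.exact_subtype_mkQ N) N.mkQ_surjective)
      (LinearMap.lTensor_surjective S N.mkQ_surjective) (ih N hN)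
      (isWeaklyRegular_baseChange_of_isTorsionBySet h _ hQ)

theorem isWeaklyRegular_baseChange_append [IsNoetherianRing R] [Module.Flat R S]
    {xs : List R} {ys : List S} {M : Type*} [AddCommGroup M] [Module R M]
    (hxs : (Ideal.ofList xs).radical = maximalIdeal R) (hM : IsWeaklyRegular M xs)
    (hys : IsWeaklyRegular (S ⧸ (maximalIdeal R).map (algebraMap R S)) ys) :
    IsWeaklyRegular (S ⊗[R] M) (xs.map (algebraMap R S) ++ ys) := by
  rw [isWeaklyRegular_append_iff]
  refine ⟨hM.of_flat_of_isBaseChange (TensorProduct.isBaseChange R M S), ?_⟩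
  obtain ⟨n, hn⟩ := (Ideal.ofList xs).exists_radical_pow_le_of_fg (IsNoetherian.noetherian _)
  rw [hxs] at hn
  rw [← Ideal.map_ofList]
  refine ((tensorQuotMapSMulEquivTensorQuot M S (Ideal.ofList xs)).isWeaklyRegular_congr ys).mpr
    (isWeaklyRegular_baseChange_of_pow_smul_top hys n _ ?_)
  rw [eq_bot_iff]
  refine (Submodule.smul_mono_left hn).trans (Submodule.smul_le.mpr fun r hr m _ => ?_)
  exact Module.isTorsionBySet_quotient_ideal_smul M (Ideal.ofList xs) (x := m) (a := ⟨r, hr⟩)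

/-- If `m B ≠ B` then `n (S ⊗ B) ≠ S ⊗ B` for a local homomorphism `(R, m) → (S, n)`. -/
theorem map_maximalIdeal_tensorProduct_ne_top [IsLocalRing S] [IsLocalHom (algebraMap R S)]
    {B : Type*} [CommRing B] [Algebra R B]
    (hB : (maximalIdeal R).map (algebraMap R B) ≠ ⊤) :
    (maximalIdeal S).map (algebraMap S (S ⊗[R] B)) ≠ ⊤ := by
  have hBn : Nontrivial (B ⧸ (maximalIdeal R).map (algebraMap R B)) :=
    Ideal.Quotient.nontrivial_iff.mpr hB
  let _ : Algebra (ResidueField R) (B ⧸ (maximalIdeal R).map (algebraMap R B)) :=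
    inferInstanceAs (Algebra (R ⧸ maximalIdeal R) (B ⧸ (maximalIdeal R).map (algebraMap R B)))
  have : IsScalarTower R (ResidueField R) (B ⧸ (maximalIdeal R).map (algebraMap R B)) :=
    inferInstanceAs (IsScalarTower R (R ⧸ maximalIdeal R) _)
  let L := ResidueField S ⊗[ResidueField R] (B ⧸ (maximalIdeal R).map (algebraMap R B))
  let f : S →ₐ[R] L := Algebra.TensorProduct.includeLeft.comp
    (IsScalarTower.toAlgHom R S (ResidueField S))
  let g : B →ₐ[R] L :=
    ((Algebra.TensorProduct.includeRight (R := ResidueField R) (A := ResidueField S)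
      (B := B ⧸ (maximalIdeal R).map (algebraMap R B))).restrictScalars R).comp
      (Ideal.Quotient.mkₐ R _)
  have hf : (maximalIdeal S).map (algebraMap S (S ⊗[R] B)) ≤
      RingHom.ker (Algebra.TensorProduct.productMap f g) := by
    refine Ideal.map_le_iff_le_comap.mpr fun s hs => ?_
    have : residue S s = 0 := (residue_eq_zero_iff s).mpr hs
    have : f s = 0 := (congrArg (· ⊗ₜ[ResidueField R] 1) this).trans (zero_tmul _ _)
    simp [this]
  intro h
  exact RingHom.ker_ne_top _ (top_le_iff.mp (h ▸ hf))

end BaseChange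

theorem Fin.range_append {α : Type*} {n k : ℕ} (a : Fin n → α) (b : Fin k → α) :
    Set.range (Fin.append a b) = Set.range a ∪ Set.range b := by
  ext c
  constructor
  · rintro ⟨i, rfl⟩
    refine Fin.addCases (fun i => ?_) (fun i => ?_) i
    · exact Or.inl ⟨i, (Fin.append_left a b i).symm⟩
    · exact Or.inr ⟨i, (Fin.append_right a b i).symm⟩
  · rintro (⟨i, rfl⟩ | ⟨i, rfl⟩)
    · exact ⟨Fin.castAdd k i, Fin.append_left a b i⟩
    · exact ⟨Fin.natAdd n i, Fin.append_right a b i⟩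

theorem exists_isSOP (A : Type*) [CommRing A] [IsLocalRing A] [IsNoetherianRing A] :
    ∃ (n : ℕ) (x : Fin n → A), IsSOP A x := by
  obtain ⟨s, hs, hc⟩ := (maximalIdeal A).exists_finset_card_eq_height_of_isNoetherianRing
  have hr : Set.range (fun i => (s.equivFin.symm i : A)) = s := by
    rw [Set.range_comp' Subtype.val, s.equivFin.symm.range_eq_univ]; simp
  refine ⟨s.card, fun i => s.equivFin.symm i, ?_, fun i => ?_, ?_⟩
  · rw [← maximalIdeal_height_eq_ringKrullDim, ← hc]; rfl
  · exact hs.1.2 (Ideal.subset_span (s.equivFin.symm i).2)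
  · rw [hr]
    refine le_antisymm ((Ideal.IsPrime.radical_le_iff inferInstance).mpr hs.1.2) ?_
    rw [Ideal.radical_eq_sInf]
    exact le_sInf fun J ⟨hJ, hJp⟩ => hs.2 ⟨hJp, hJ⟩ (le_maximalIdeal hJp.ne_top)

theorem isSOP_append {R S : Type*} [CommRing R] [IsLocalRing R] [IsNoetherianRing R]
    [CommRing S] [IsLocalRing S] [IsNoetherianRing S]
    [Algebra R S] [Module.Flat R S] [IsLocalHom (algebraMap R S)]
    [IsLocalRing (S ⧸ (maximalIdeal R).map (algebraMap R S))]
    {n k : ℕ} {x : Fin n → R} {y : Fin k → S} (hx : IsSOP R x)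
    (hy : IsSOP (S ⧸ (maximalIdeal R).map (algebraMap R S)) fun i => Ideal.Quotient.mk _ (y i)) :
    IsSOP S (Fin.append (fun i => algebraMap R S (x i)) y) := by
  obtain ⟨hx₁, hx₂, hx₃⟩ := hx
  obtain ⟨hy₁, hy₂, hy₃⟩ := hy
  set q := Ideal.Quotient.mk ((maximalIdeal R).map (algebraMap R S))
  have hq : (maximalIdeal S).map q = maximalIdeal _ :=
    map_maximalIdeal_of_surjective q Ideal.Quotient.mk_surjective
  have hq' : IsLocalHom q := .of_surjective _ Ideal.Quotient.mk_surjective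
  have hmem : ∀ i, Fin.append (fun i => algebraMap R S (x i)) y i ∈ maximalIdeal S := by
    refine Fin.addCases (fun i => ?_) fun i => ?_
    · rw [Fin.append_left]
      exact (map_mem_nonunits_iff (algebraMap R S) (x i)).mpr (hx₂ i)
    · rw [Fin.append_right, ← maximalIdeal_comap q]
      exact hy₂ i
  refine ⟨?_, hmem, ?_⟩
  · have : (maximalIdeal S).LiesOver (maximalIdeal R) := inferInstance
    have h := Ideal.height_eq_height_add_of_liesOver_of_hasGoingDown
      (maximalIdeal R) (maximalIdeal S)
    rw [hq] at h
    rw [← maximalIdeal_height_eq_ringKrullDim] at hx₁ hy₁ ⊢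
    rw [h, Nat.cast_add, hx₁, hy₁, WithBot.coe_add]
  · refine le_antisymm ((Ideal.IsPrime.radical_le_iff inferInstance).mpr
      (Ideal.span_le.mpr (Set.range_subset_iff.mpr hmem))) fun s hs => ?_
    rw [Fin.range_append, Ideal.span_union, Set.range_comp' (algebraMap R S), ← Ideal.map_span]
    have hs' : q s ∈ (Ideal.span (Set.range fun i => q (y i))).radical :=
      hy₃ ▸ hq ▸ Ideal.mem_map_of_mem q hs
    obtain ⟨a, ha⟩ := hs'
    rw [Set.range_comp' q, ← Ideal.map_span, ← map_pow, ← Ideal.mem_comap,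
      Ideal.comap_map_of_surjective' _ Ideal.Quotient.mk_surjective, Ideal.mk_ker] at ha
    rw [← Ideal.radical_idem]
    refine ⟨a, SetLike.le_def.mp (sup_le (le_sup_right.trans Ideal.le_radical) ?_) ha⟩
    rw [← hx₃]
    exact (Ideal.map_radical_le _).trans (Ideal.radical_mono le_sup_left)

/-- **Proposition (Dietz, Prop. 8.6 / `seedflat`).** Let `(R,m) → (S,n)` be a flat local
homomorphism of Noetherian local rings whose closed fiber `S/mS` is Cohen-Macaulay.
If `T` is a seed over `R`, then `T ⊗_R S` is a seed over `S`. -/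
theorem seed_flat_base_change
    (R : Type u) [CommRing R] [IsLocalRing R] [IsNoetherianRing R]
    (S : Type u) [CommRing S] [IsLocalRing S] [IsNoetherianRing S]
    [Algebra R S] [Module.Flat R S] [IsLocalHom (algebraMap R S)]
    [IsLocalRing (S ⧸ (maximalIdeal R).map (algebraMap R S))]
    (hCM : IsCohenMacaulayLocalRing (S ⧸ (maximalIdeal R).map (algebraMap R S)))
    (T : Type u) [CommRing T] [Algebra R T] (hT : IsSeed R T) :
    IsSeed S (TensorProduct R S T) := by
  obtain ⟨B, _, _, ⟨⟨n, x, hx, hxB⟩, hB⟩, ⟨f⟩⟩ := hT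
  obtain ⟨k, y', hy'⟩ := exists_isSOP (S ⧸ (maximalIdeal R).map (algebraMap R S))
  obtain ⟨y, rfl⟩ : ∃ y : Fin k → S, y' = fun i => Ideal.Quotient.mk _ (y i) :=
    ⟨fun i => (y' i).out, funext fun i => (Ideal.Quotient.mk_out _).symm⟩
  have hsop := isSOP_append hx hy'
  have htop := map_maximalIdeal_tensorProduct_ne_top (S := S) hB
  have hyS : IsWeaklyRegular (S ⧸ (maximalIdeal R).map (algebraMap R S)) (List.ofFn y) := by
    rw [← isWeaklyRegular_map_algebraMap_iff (S ⧸ (maximalIdeal R).map (algebraMap R S)),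
      List.map_ofFn]
    exact (hCM k _ hy').toIsWeaklyRegular
  have hreg := isWeaklyRegular_baseChange_append
    (by rw [Ideal.ofList, ← hx.2.2]; congr; ext; simp) hxB.toIsWeaklyRegular hyS
  refine ⟨S ⊗[R] B, inferInstance, inferInstance, ⟨⟨n + k, _, hsop, ?_, ?_⟩, htop⟩,
    ⟨Algebra.TensorProduct.map (AlgHom.id S S) f⟩⟩
  · rw [List.ofFn_fin_append]
    rwa [List.map_ofFn] at hreg
  · intro h
    apply htop
    rw [Ideal.smul_top_eq_map] at h
    refine top_le_iff.mp fun b _ => Ideal.map_mono ?_ (h.le (Submodule.mem_top (x := b)))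
    refine Ideal.span_le.mpr fun s hs => ?_
    obtain ⟨i, rfl⟩ := List.mem_ofFn.mp hs
    exact hsop.2.1 i
end

section
/- Let R → S be a surjective local homomorphism of complete Noetherian local domains of positive prime characteristic p. If T is a seed over R, then T ⊗_R S is a seed over S. -/
open IsLocalRing

universe u v w

section
open scoped Pointwise

section DerivedComplete

open RingTheory.Sequence Submodule

/-- The map `(u_k) ↦ (u_k - a u_{k+1})` on sequences in `M` is bijective; equivalently `M` is
derived complete with respect to the element `a`. -/
def IsDerivedComplete {R : Type*} [CommRing R] (a : R) (M : Type*) [AddCommGroup M] [Module R M] :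
    Prop :=
  Function.Bijective fun (u : ℕ → M) (k : ℕ) => u k - a • u (k + 1)

variable {R : Type*} [CommRing R] {M N : Type*} [AddCommGroup M] [Module R M]
  [AddCommGroup N] [Module R N]

lemma IsDerivedComplete.eq_zero {a : R} (h : IsDerivedComplete a M) {u : ℕ → M}
    (hu : ∀ k, u k = a • u (k + 1)) (k : ℕ) : u k = 0 := by
  have : u = 0 := h.1 (by funext k; simp [← hu])
  simp [this]

lemma isDerivedComplete_of {a : R}
    (h₁ : ∀ u : ℕ → M, (∀ k, u k = a • u (k + 1)) → ∀ k, u k = 0)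
    (h₂ : ∀ v : ℕ → M, ∃ u : ℕ → M, ∀ k, u k - a • u (k + 1) = v k) : IsDerivedComplete a M := by
  refine ⟨fun u u' huu => ?_, fun v => (h₂ v).imp fun u hu => funext hu⟩
  funext k
  refine sub_eq_zero.1 (h₁ (fun k => u k - u' k) (fun k => ?_) k)
  have := congrFun huu k
  simp only at this
  rw [smul_sub, sub_eq_sub_iff_sub_eq_sub, this]

lemma IsDerivedComplete.of_linearEquiv {a : R} (h : IsDerivedComplete a M) (e : M ≃ₗ[R] N) :
    IsDerivedComplete a N := by
  refine isDerivedComplete_of (fun u hu k => ?_) fun v => ?_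
  · have := h.eq_zero (u := fun k => e.symm (u k)) (fun k => by rw [← map_smul, ← hu]) k
    simpa using this
  · obtain ⟨u, hu⟩ := h.2 (fun k => e.symm (v k))
    refine ⟨fun k => e (u k), fun k => ?_⟩
    have := congrFun hu k
    simp only at this
    rw [← map_smul, ← map_sub, this, e.apply_symm_apply]

lemma IsDerivedComplete.quotSMulTop {a : R} (h : IsDerivedComplete a M) (b : R) :
    IsDerivedComplete a (QuotSMulTop b M) := by
  have hs : Function.Surjective (Submodule.Quotient.mk (p := b • (⊤ : Submodule R M))) :=
    Submodule.Quotient.mk_surjective _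
  refine isDerivedComplete_of (fun u hu k => ?_) fun v => ?_
  · choose w hw using fun k => hs (u k)
    have h1 : ∀ k, ∃ x, w k - a • w (k + 1) = b • x := by
      intro k
      have : w k - a • w (k + 1) ∈ b • (⊤ : Submodule R M) := by
        rw [← Submodule.Quotient.mk_eq_zero, Submodule.Quotient.mk_sub,
          Submodule.Quotient.mk_smul, hw, hw, ← hu, sub_self]
      obtain ⟨x, -, hx⟩ := (Submodule.mem_smul_pointwise_iff_exists _ _ _).1 this
      exact ⟨x, hx.symm⟩
    choose x hx using h1
    obtain ⟨y, hy⟩ := h.2 x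
    have h2 := h.eq_zero (u := fun k => w k - b • y k) (fun k => by
      have := congrFun hy k
      simp only at this
      have h3 := hx k
      rw [← this] at h3
      rw [smul_sub, smul_comm a b, sub_eq_sub_iff_sub_eq_sub, h3, smul_sub]) k
    rw [← hw, (sub_eq_zero.1 h2), Submodule.Quotient.mk_eq_zero]
    exact Submodule.smul_mem_pointwise_smul _ _ _ trivial
  · choose w hw using fun k => hs (v k)
    obtain ⟨y, hy⟩ := h.2 w
    refine ⟨fun k => Submodule.Quotient.mk (y k), fun k => ?_⟩
    rw [← hw, ← congrFun hy k, Submodule.Quotient.mk_sub, Submodule.Quotient.mk_smul]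

lemma IsDerivedComplete.quot_ofList {a : R} (rs : List R) : ∀ {M : Type v} [AddCommGroup M]
    [Module R M], IsDerivedComplete a M →
    IsDerivedComplete a (M ⧸ (Ideal.ofList rs • ⊤ : Submodule R M)) := by
  induction rs with
  | nil =>
    intro M _ _ h
    exact h.of_linearEquiv (quotEquivOfEqBot _ (by simp)).symm
  | cons r rs ih =>
    intro M _ _ h
    exact (ih (h.quotSMulTop r)).of_linearEquiv
      (quotOfListConsSMulTopEquivQuotSMulTopInner M r rs).symm

lemma RingTheory.Sequence.IsWeaklyRegular.perm_of_isDerivedComplete {rs rs' : List R}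
    (h : IsWeaklyRegular M rs) (hrs : ∀ r ∈ rs, IsDerivedComplete r M) (hp : rs.Perm rs') :
    IsWeaklyRegular M rs' := by
  refine h.prototype_perm hp fun a b rs'' hs hK => ?_
  set K := torsionBy R (M ⧸ (Ideal.ofList rs'' • ⊤ : Submodule R M)) b
  have ha := (hrs a (hs.subset (by simp))).quot_ofList rs''
  rw [eq_bot_iff]
  intro x hx
  have h1 : ∀ y : K, ∃ y' : K, (y : M ⧸ (Ideal.ofList rs'' • ⊤ : Submodule R M)) = a • (y' : _) := by
    rintro ⟨y, hy⟩
    rw [hK] at hy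
    obtain ⟨y', hy', rfl⟩ := (Submodule.mem_smul_pointwise_iff_exists _ _ _).1 hy
    exact ⟨⟨y', hy'⟩, rfl⟩
  choose g hg using h1
  let s : ℕ → K := fun n => Nat.rec ⟨x, hx⟩ (fun _ y => g y) n
  exact ha.eq_zero (u := fun k => (s k).1) (fun k => hg (s k)) 0

end DerivedComplete

section Exchange

open RingTheory.Sequence Submodule

variable {R : Type*} [CommRing R]

lemma isSMulRegular_of_pow_mem {M : Type*} [AddCommGroup M] [Module R M] {I : Ideal R}
    {a b : R} {k : ℕ}
    (hI : ∀ r ∈ I, ∀ x : M, r • x = 0) (ha : IsSMulRegular M a)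
    (hab : a ^ k ∈ I ⊔ Ideal.span {b}) : IsSMulRegular M b := by
  rw [isSMulRegular_iff_right_eq_zero_of_smul]
  intro x hx
  obtain ⟨i, hi, c, hc, hic⟩ := Submodule.mem_sup.1 hab
  obtain ⟨d, rfl⟩ := Ideal.mem_span_singleton'.1 hc
  have : a ^ k • x = 0 := by
    rw [← hic, add_smul, hI i hi, mul_smul, hx, smul_zero, add_zero]
  exact (ha.pow k).right_eq_zero_of_smul this

lemma IsLocalRing.exists_mem_maximalIdeal_le_radical [IsLocalRing R] [IsNoetherianRing R]
    {A A' : Ideal R} {a a' : R}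
    (ha : a ∈ maximalIdeal R) (ha' : a' ∈ maximalIdeal R)
    (h : maximalIdeal R ≤ (A ⊔ Ideal.span {a}).radical)
    (h' : maximalIdeal R ≤ (A' ⊔ Ideal.span {a'}).radical) :
    ∃ u ∈ maximalIdeal R, maximalIdeal R ≤ (A ⊔ Ideal.span {u}).radical ∧
      maximalIdeal R ≤ (A' ⊔ Ideal.span {u}).radical := by
  have hf : {q ∈ A.minimalPrimes ∪ A'.minimalPrimes | q ≠ maximalIdeal R}.Finite :=
    ((A.finite_minimalPrimes_of_isNoetherianRing R).union
      (A'.finite_minimalPrimes_of_isNoetherianRing R)).subset (Set.sep_subset _ _)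
  have hne : ¬ ((maximalIdeal R : Set R) ⊆
      ⋃ q ∈ (hf.toFinset : Set (Ideal R)), ((q : Ideal R) : Set R)) := by
    rw [Ideal.subset_union_prime ⊥ ⊥]
    · rintro ⟨q, hq, hle⟩
      obtain ⟨hq, hne⟩ := hf.mem_toFinset.1 hq
      have hqp : q.IsPrime := by
        rcases hq with hq | hq <;> exact hq.1.1
      exact hne (le_antisymm (le_maximalIdeal hqp.ne_top) hle)
    · intro q hq _ _
      rcases (hf.mem_toFinset.1 hq).1 with hq | hq <;> exact hq.1.1
  obtain ⟨u, hu, hun⟩ := Set.not_subset.1 hne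
  have key : ∀ {A : Ideal R} {a : R}, a ∈ maximalIdeal R →
      maximalIdeal R ≤ (A ⊔ Ideal.span {a}).radical →
      (∀ q ∈ A.minimalPrimes, q ≠ maximalIdeal R → u ∉ q) →
      maximalIdeal R ≤ (A ⊔ Ideal.span {u}).radical := by
    intro A a ha h hA
    rw [Ideal.radical_eq_sInf]
    refine le_sInf ?_
    rintro q ⟨hq, hqp⟩
    by_contra hmq
    have hqm : q < maximalIdeal R :=
      lt_of_le_of_ne (le_maximalIdeal hqp.ne_top) fun e => hmq e.ge
    have hAq : A ≤ q := le_sup_left.trans hq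
    have hspan : Ideal.span (insert a (A : Set R)) = A ⊔ Ideal.span {a} := by
      rw [Ideal.span_insert, Ideal.span_eq, sup_comm]
    have := Ideal.mem_minimalPrimes_span_of_mem_minimalPrimes_span_insert hqm a (A : Set R)
      (by
        rw [hspan]
        refine ⟨⟨inferInstance, sup_le (hAq.trans hqm.le) ?_⟩, fun p hp _ => ?_⟩
        · rwa [Ideal.span_singleton_le_iff_mem]
        · exact h.trans ((Ideal.IsPrime.radical_le_iff hp.1).2 hp.2))
      (A : Set R) hAq (by
        rw [hspan]
        exact (le_sup_left : A ≤ A ⊔ Ideal.span {a}).trans Ideal.le_radical)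
    rw [Ideal.span_eq] at this
    exact hA q this hqm.ne (hq (le_sup_right (a := A) (Ideal.mem_span_singleton_self u)))
  refine ⟨u, hu, key ha h fun q hq hne huq => hun ?_, key ha' h' fun q hq hne huq => hun ?_⟩
  · exact Set.mem_biUnion (hf.mem_toFinset.2 ⟨Or.inl hq, hne⟩) huq
  · exact Set.mem_biUnion (hf.mem_toFinset.2 ⟨Or.inr hq, hne⟩) huq

lemma smul_quot_eq_zero_of_mem_sup {M : Type*} [AddCommGroup M] [Module R M] {I : Ideal R}
    (hI : ∀ r ∈ I, ∀ x : M, r • x = 0) (J : Ideal R) {r : R} (hr : r ∈ I ⊔ J)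
    (x : M ⧸ (J • ⊤ : Submodule R M)) : r • x = 0 := by
  obtain ⟨y, rfl⟩ := Submodule.Quotient.mk_surjective _ x
  obtain ⟨i, hi, j, hj, rfl⟩ := Submodule.mem_sup.1 hr
  rw [add_smul, ← Submodule.Quotient.mk_smul, hI i hi, ← Submodule.Quotient.mk_smul,
    Submodule.Quotient.mk_zero, zero_add, Submodule.Quotient.mk_eq_zero]
  exact Submodule.smul_mem_smul hj trivial

lemma smul_quotSMulTop_eq_zero_of_mem_sup {M : Type*} [AddCommGroup M] [Module R M] {I : Ideal R}
    (hI : ∀ r ∈ I, ∀ x : M, r • x = 0) (a : R) {r : R} (hr : r ∈ I ⊔ Ideal.span {a})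
    (x : QuotSMulTop a M) : r • x = 0 := by
  obtain ⟨y, rfl⟩ := Submodule.Quotient.mk_surjective _ x
  obtain ⟨i, hi, j, hj, rfl⟩ := Submodule.mem_sup.1 hr
  obtain ⟨c, rfl⟩ := Ideal.mem_span_singleton'.1 hj
  rw [add_smul, ← Submodule.Quotient.mk_smul, hI i hi, ← Submodule.Quotient.mk_smul,
    Submodule.Quotient.mk_zero, zero_add, Submodule.Quotient.mk_eq_zero, mul_comm, mul_smul]
  exact Submodule.smul_mem_pointwise_smul _ _ _ trivial

/-- On a derived complete module, a weakly regular sequence may be replaced by any sequence of the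
same length that generates an `𝔪`-primary ideal. -/
theorem RingTheory.Sequence.IsWeaklyRegular.exchange [IsLocalRing R] [IsNoetherianRing R] (n : ℕ) :
    ∀ {M : Type v} [AddCommGroup M] [Module R M] {I : Ideal R} {zs ws : List R},
    (∀ r ∈ I, ∀ x : M, r • x = 0) → zs.length = n → ws.length = n →
    (∀ r ∈ zs, r ∈ maximalIdeal R) → (∀ r ∈ ws, r ∈ maximalIdeal R) →
    maximalIdeal R ≤ (I ⊔ Ideal.ofList zs).radical →
    maximalIdeal R ≤ (I ⊔ Ideal.ofList ws).radical →
    (∀ a ∈ maximalIdeal R, IsDerivedComplete a M) →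
    IsWeaklyRegular M zs → IsWeaklyRegular M ws := by
  induction n with
  | zero =>
    intro M _ _ I zs ws _ _ hw _ _ _ _ _ _
    rw [List.length_eq_zero_iff.1 hw]
    exact .nil R M
  | succ n ih =>
    intro M _ _ I zs ws hI hz hw hzm hwm hzr hwr hM hreg
    obtain ⟨zs, a, rfl⟩ := List.eq_nil_or_concat' zs |>.resolve_left (by rintro rfl; simp at hz)
    obtain ⟨ws, b, rfl⟩ := List.eq_nil_or_concat' ws |>.resolve_left (by rintro rfl; simp at hw)
    rw [Ideal.ofList_append, Ideal.ofList_singleton, ← sup_assoc] at hzr hwr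
    have ha : a ∈ maximalIdeal R := hzm a (by simp)
    have hb : b ∈ maximalIdeal R := hwm b (by simp)
    obtain ⟨u, hu, hu₁, hu₂⟩ := exists_mem_maximalIdeal_le_radical ha hb hzr hwr
    have repl : ∀ {rs : List R} {a b : R}, a ∈ maximalIdeal R →
        maximalIdeal R ≤ (I ⊔ Ideal.ofList rs ⊔ Ideal.span {b}).radical →
        IsWeaklyRegular M (rs ++ [a]) → IsWeaklyRegular M (rs ++ [b]) := by
      intro rs a b ha hr h
      rw [isWeaklyRegular_append_iff, isWeaklyRegular_singleton_iff] at h ⊢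
      obtain ⟨k, hk⟩ := hr ha
      exact ⟨h.1, isSMulRegular_of_pow_mem
        (fun r hr => smul_quot_eq_zero_of_mem_sup hI _ hr) h.2 hk⟩
    have h1 : IsWeaklyRegular M (u :: zs) := by
      refine (repl ha hu₁ hreg).perm_of_isDerivedComplete (fun r hr => hM r ?_) (by simp)
      rcases List.mem_append.1 hr with hr | hr
      · exact hzm r (by simp [hr])
      · rw [List.mem_singleton.1 hr]; exact hu
    rw [isWeaklyRegular_cons_iff] at h1
    have h2 : IsWeaklyRegular M (u :: ws) := by
      rw [isWeaklyRegular_cons_iff]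
      refine ⟨h1.1, ih (I := I ⊔ Ideal.span {u})
        (fun r hr => smul_quotSMulTop_eq_zero_of_mem_sup hI u hr)
        (by simpa using hz) (by simpa using hw) (fun r hr => hzm r (by simp [hr]))
        (fun r hr => hwm r (by simp [hr])) ?_ ?_ (fun a ha => (hM a ha).quotSMulTop u) h1.2⟩
      · rwa [sup_right_comm]
      · rwa [sup_right_comm]
    refine repl hu hwr (h2.perm_of_isDerivedComplete (fun r hr => hM r ?_)
      (List.perm_append_singleton u ws).symm)
    rcases List.mem_cons.1 hr with rfl | hr
    · exact hu
    · exact hwm r (by simp [hr])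

end Exchange

section WeaklyRegular

open RingTheory.Sequence Submodule Function

variable {R : Type*} [CommRing R] {A M C : Type v} [AddCommGroup A] [Module R A]
  [AddCommGroup M] [Module R M] [AddCommGroup C] [Module R C]

lemma QuotSMulTop.map_injective_of_exact_s7 {f : A →ₗ[R] M} {g : M →ₗ[R] C} (hf : Injective f)
    (hfg : Exact f g) {r : R} (h : IsSMulRegular C r) : Injective (QuotSMulTop.map r f) := by
  have h0 : Exact (0 : A →ₗ[R] A) f := fun x =>
    ⟨fun hx => ⟨0, by simpa using (hf (hx.trans (map_zero f).symm)).symm⟩,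
      by rintro ⟨y, rfl⟩; simp⟩
  have := QuotSMulTop.map_first_exact_on_four_term_exact_of_isSMulRegular_last h0 hfg h
  rw [injective_iff_map_eq_zero]
  intro x hx
  obtain ⟨y, rfl⟩ := (this x).1 hx
  simp

lemma RingTheory.Sequence.IsWeaklyRegular.mem_smul_top_of_exact {f : A →ₗ[R] M} {g : M →ₗ[R] C}
    (hf : Injective f) (hfg : Exact f g) (hg : Surjective g) {rs : List R}
    (h : IsWeaklyRegular C rs) {x : A} (hx : f x ∈ (Ideal.ofList rs • ⊤ : Submodule R M)) :
    x ∈ (Ideal.ofList rs • ⊤ : Submodule R A) := by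
  have h0 : Exact (0 : A →ₗ[R] A) f := fun x =>
    ⟨fun hx => ⟨0, by simpa using (hf (hx.trans (map_zero f).symm)).symm⟩,
      by rintro ⟨y, rfl⟩; simp⟩
  have := map_first_exact_on_four_term_right_exact_of_isSMulRegular_last h0 hfg hg h
  rw [← Submodule.Quotient.mk_eq_zero] at hx ⊢
  obtain ⟨y, hy⟩ := (this (Submodule.Quotient.mk x)).1 (by simpa using hx)
  rw [← hy]
  obtain ⟨y, rfl⟩ := Submodule.Quotient.mk_surjective _ y
  simp

lemma RingTheory.Sequence.IsWeaklyRegular.mem_smul_top_of_smul_mem {r : R} {rs : List R}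
    (h : IsWeaklyRegular M (r :: rs)) {x : M}
    (hx : r • x ∈ (Ideal.ofList rs • ⊤ : Submodule R M)) :
    x ∈ (Ideal.ofList rs • ⊤ : Submodule R M) := by
  rw [isWeaklyRegular_cons_iff] at h
  refine IsWeaklyRegular.mem_smul_top_of_exact (f := LinearMap.lsmul R M r)
    (g := (r • (⊤ : Submodule R M)).mkQ) h.1 (fun y => ?_) (Submodule.mkQ_surjective _) h.2 hx
  rw [Submodule.mkQ_apply, Submodule.Quotient.mk_eq_zero, Submodule.mem_smul_pointwise_iff_exists]
  simp

/-- Weak regularity is closed under extensions of modules. -/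
lemma RingTheory.Sequence.IsWeaklyRegular.of_exact_s7 {rs : List R} :
    ∀ {A M C : Type v} [AddCommGroup A] [Module R A] [AddCommGroup M] [Module R M]
    [AddCommGroup C] [Module R C] {f : A →ₗ[R] M} {g : M →ₗ[R] C},
    Injective f → Exact f g → Surjective g → IsWeaklyRegular A rs → IsWeaklyRegular C rs →
    IsWeaklyRegular M rs := by
  induction rs with
  | nil => intros; exact .nil R _
  | cons r rs ih =>
    intro A M C _ _ _ _ _ _ f g hf hfg hg hA hC
    rw [isWeaklyRegular_cons_iff] at hA hC ⊢
    refine ⟨?_, ih (QuotSMulTop.map_injective_of_exact_s7 hf hfg hC.1) (QuotSMulTop.map_exact r hfg hg)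
      (QuotSMulTop.map_surjective r hg) hA.2 hC.2⟩
    rw [isSMulRegular_iff_right_eq_zero_of_smul] at hA hC ⊢
    intro x hx
    obtain ⟨a, rfl⟩ := (hfg x).1 (hC.1 _ (by rw [← map_smul, hx, map_zero]))
    rw [hA.1 a (hf (by rw [map_smul, hx, map_zero])), map_zero]

lemma RingTheory.Sequence.IsWeaklyRegular.quotSMulTop_pow {r : R} {rs : List R}
    (hr : IsSMulRegular M r) (h : IsWeaklyRegular (QuotSMulTop r M) rs) (n : ℕ) :
    IsWeaklyRegular (QuotSMulTop (r ^ n) M) rs := by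
  induction n with
  | zero =>
    have : Subsingleton (QuotSMulTop (r ^ 0) M) := by
      rw [pow_zero]
      exact Submodule.Quotient.subsingleton_iff.2 (by simp)
    rw [isWeaklyRegular_iff]
    intro i hi
    exact fun x y _ => Subsingleton.elim _ _
  | succ n ih =>
    have h1 : r ^ n • (⊤ : Submodule R M) ≤ (r ^ (n + 1) • (⊤ : Submodule R M)).comap
        (LinearMap.lsmul R M r) := by
      intro x hx
      obtain ⟨y, -, rfl⟩ := (Submodule.mem_smul_pointwise_iff_exists _ _ _).1 hx
      rw [Submodule.mem_comap, LinearMap.lsmul_apply, smul_smul, ← pow_succ']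
      exact Submodule.smul_mem_pointwise_smul _ _ _ trivial
    have h2 : r ^ (n + 1) • (⊤ : Submodule R M) ≤ r • (⊤ : Submodule R M) := by
      intro x hx
      obtain ⟨y, -, rfl⟩ := (Submodule.mem_smul_pointwise_iff_exists _ _ _).1 hx
      rw [pow_succ', mul_smul]
      exact Submodule.smul_mem_pointwise_smul _ _ _ trivial
    refine IsWeaklyRegular.of_exact_s7 (f := Submodule.mapQ _ _ (LinearMap.lsmul R M r) h1)
      (g := Submodule.factor h2) ?_ ?_ (Submodule.factor_surjective h2) ih h
    · rw [injective_iff_map_eq_zero]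
      intro x hx
      obtain ⟨x, rfl⟩ := Submodule.Quotient.mk_surjective _ x
      rw [Submodule.mapQ_apply, Submodule.Quotient.mk_eq_zero,
        Submodule.mem_smul_pointwise_iff_exists] at hx
      obtain ⟨y, -, hy⟩ := hx
      rw [LinearMap.lsmul_apply, pow_succ', mul_smul] at hy
      rw [← hr hy, Submodule.Quotient.mk_eq_zero]
      exact Submodule.smul_mem_pointwise_smul _ _ _ trivial
    · intro x
      obtain ⟨x, rfl⟩ := Submodule.Quotient.mk_surjective _ x
      constructor
      · intro hx
        have hx' : x ∈ r • (⊤ : Submodule R M) := (Submodule.Quotient.mk_eq_zero _).1 hx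
        obtain ⟨y, -, rfl⟩ := (Submodule.mem_smul_pointwise_iff_exists _ _ _).1 hx'
        exact ⟨Submodule.Quotient.mk y, rfl⟩
      · rintro ⟨y, hy⟩
        obtain ⟨y, rfl⟩ := Submodule.Quotient.mk_surjective _ y
        rw [← hy]
        exact (Submodule.Quotient.mk_eq_zero _).2
          (Submodule.smul_mem_pointwise_smul y r ⊤ trivial)

lemma RingTheory.Sequence.IsWeaklyRegular.map_pow {rs : List R} (n : ℕ) :
    ∀ {M : Type v} [AddCommGroup M] [Module R M], IsWeaklyRegular M rs →
    IsWeaklyRegular M (rs.map (· ^ n)) := by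
  induction rs with
  | nil => intros; exact .nil R _
  | cons r rs ih =>
    intro M _ _ h
    rw [isWeaklyRegular_cons_iff] at h
    rw [List.map_cons, isWeaklyRegular_cons_iff]
    exact ⟨h.1.pow n, .quotSMulTop_pow h.1 (ih h.2) n⟩

lemma Ideal.le_radical_sup_ofList_map_pow {I J : Ideal R} {rs : List R}
    (h : J ≤ (I ⊔ Ideal.ofList rs).radical) (n : ℕ) :
    J ≤ (I ⊔ Ideal.ofList (rs.map (· ^ n))).radical := by
  refine h.trans ?_
  rw [← Ideal.radical_idem (I ⊔ Ideal.ofList (rs.map (· ^ n)))]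
  refine Ideal.radical_mono (sup_le (le_sup_left.trans Ideal.le_radical) ?_)
  rw [Ideal.ofList, Ideal.span_le]
  intro r hr
  refine ⟨n, le_sup_right (a := I) (Ideal.subset_span ?_)⟩
  exact List.mem_map_of_mem (f := (· ^ n)) hr

end WeaklyRegular

section Completion

open RingTheory.Sequence Submodule Function

variable {R : Type*} [CommRing R]

lemma exists_mem_pow_smul_top_of_smul_mem {M : Type*} [AddCommGroup M] [Module R M] {I J : Ideal R}
    (hJ : J.FG)
    {z : R} {zs : List R} (hI : ∀ r ∈ I, ∀ x : M, r • x = 0) (hz : z ∈ J) (hzs : ∀ r ∈ zs, r ∈ J)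
    (hrad : J ≤ (I ⊔ Ideal.ofList (z :: zs)).radical) (h : IsWeaklyRegular M (z :: zs)) (n : ℕ) :
    ∃ N, ∀ x : M, z • x ∈ (J ^ N • ⊤ : Submodule R M) → x ∈ (J ^ n • ⊤ : Submodule R M) := by
  obtain ⟨N, hN⟩ := Ideal.exists_pow_le_of_le_radical_of_fg
    (Ideal.le_radical_sup_ofList_map_pow hrad (n + 1)) hJ
  have hn : Ideal.ofList (zs.map (· ^ (n + 1))) ≤ J ^ n := by
    rw [Ideal.ofList, Ideal.span_le]
    intro r hr
    obtain ⟨a, ha, rfl⟩ := List.mem_map.1 (show r ∈ zs.map (· ^ (n + 1)) from hr)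
    exact Ideal.pow_le_pow_right n.le_succ (Ideal.pow_mem_pow (hzs a ha) _)
  refine ⟨N, fun x hx => ?_⟩
  have hx1 := Submodule.smul_mono_left hN hx
  rw [Submodule.sup_smul] at hx1
  have hbot : (I • ⊤ : Submodule R M) = ⊥ := by
    rw [eq_bot_iff, Submodule.smul_le]
    intro r hr m _
    simp [hI r hr m]
  rw [hbot, bot_sup_eq, List.map_cons, Ideal.ofList_cons, Submodule.sup_smul] at hx1
  obtain ⟨a, ha, b, hb, hab⟩ := Submodule.mem_sup.1 hx1
  rw [Submodule.ideal_span_singleton_smul, Submodule.mem_smul_pointwise_iff_exists] at ha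
  obtain ⟨y, -, rfl⟩ := ha
  have h' : IsWeaklyRegular M (z :: zs.map (· ^ (n + 1))) := by
    rw [isWeaklyRegular_cons_iff] at h ⊢
    exact ⟨h.1, h.2.map_pow _⟩
  have := h'.mem_smul_top_of_smul_mem (x := x - z ^ n • y) (by
    rw [smul_sub, smul_smul, ← pow_succ', ← hab, add_sub_cancel_left]
    exact hb)
  rw [← sub_add_cancel x (z ^ n • y)]
  exact add_mem (Submodule.smul_mono_left hn this)
    (Submodule.smul_mem_smul (Ideal.pow_mem_pow hz n) trivial)

theorem RingTheory.Sequence.IsWeaklyRegular.adicCompletion {J : Ideal R} (hJ : J.FG)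
    {zs : List R} : ∀ {M : Type v} [AddCommGroup M] [Module R M] {I : Ideal R},
    (∀ r ∈ I, ∀ x : M, r • x = 0) → (∀ r ∈ zs, r ∈ J) →
    J ≤ (I ⊔ Ideal.ofList zs).radical → IsWeaklyRegular M zs →
    IsWeaklyRegular (AdicCompletion J M) zs := by
  induction zs with
  | nil => intros; exact .nil R _
  | cons z zs ih =>
    intro M _ _ I hI hzs hrad h
    have key := exists_mem_pow_smul_top_of_smul_mem hJ hI (hzs z (by simp))
      (fun r hr => hzs r (by simp [hr])) hrad h
    have key' : ∀ n, ∃ N, n ≤ N ∧ ∀ x : M, z • x ∈ (J ^ N • ⊤ : Submodule R M) →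
        x ∈ (J ^ n • ⊤ : Submodule R M) := fun n => by
      obtain ⟨N, hN⟩ := key n
      exact ⟨max n N, le_max_left _ _, fun x hx => hN x
        (Submodule.smul_mono_left (Ideal.pow_le_pow_right (le_max_right _ _)) hx)⟩
    choose N hnN hN using key'
    rw [isWeaklyRegular_cons_iff] at h ⊢
    have hreg : IsSMulRegular (AdicCompletion J M) z := by
      rw [isSMulRegular_iff_right_eq_zero_of_smul]
      intro x hx
      obtain ⟨u, rfl⟩ := AdicCompletion.mk_surjective J M x
      ext n
      have h1 := congrArg (fun y => y.val (N n)) hx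
      rw [← map_smul] at h1
      simp only [AdicCompletion.mk_apply_coe, AdicCompletion.val_zero_apply,
        AdicCompletion.AdicCauchySequence.smul_apply, Submodule.mkQ_apply, Submodule.Quotient.mk_eq_zero] at h1
      exact (AdicCompletion.AdicCauchySequence.mk_eq_mk (hnN n) u).symm.trans
        ((Submodule.Quotient.mk_eq_zero _).2 (hN n _ h1))
    let f : AdicCompletion J M →ₗ[R] AdicCompletion J (QuotSMulTop z M) :=
      (AdicCompletion.map J (z • (⊤ : Submodule R M)).mkQ).restrictScalars R
    have hf : Surjective f := AdicCompletion.map_surjective J (Submodule.mkQ_surjective _)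
    have hker : z • (⊤ : Submodule R (AdicCompletion J M)) = LinearMap.ker f := by
      refine le_antisymm (fun x hx => ?_) fun x hx => ?_
      · obtain ⟨y, -, rfl⟩ := (Submodule.mem_smul_pointwise_iff_exists _ _ _).1 hx
        rw [LinearMap.mem_ker, map_smul]
        obtain ⟨u, hu⟩ := AdicCompletion.mk_surjective J _ (f y)
        rw [← hu, ← map_smul, show z • u = 0 from AdicCompletion.AdicCauchySequence.ext fun n =>
          smul_quotSMulTop_eq_zero_of_mem_sup hI z
            (le_sup_right (a := I) (Ideal.mem_span_singleton_self z)) (u n), map_zero]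
      · obtain ⟨u, rfl⟩ := AdicCompletion.mk_surjective J M x
        have h1 : ∀ n, ∃ v : M, u n - z • v ∈ (J ^ n • ⊤ : Submodule R M) := by
          intro n
          have h2 := congrArg (fun y => y.val n) hx
          simp only [f, LinearMap.restrictScalars_apply, AdicCompletion.map_mk,
            AdicCompletion.mk_apply_coe, AdicCompletion.val_zero_apply,
            AdicCompletion.AdicCauchySequence.map_apply_coe, Submodule.mkQ_apply,
            Submodule.Quotient.mk_eq_zero] at h2
          have h3 : (J ^ n • ⊤ : Submodule R (QuotSMulTop z M)) =
              (J ^ n • ⊤ : Submodule R M).map (z • (⊤ : Submodule R M)).mkQ := by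
            rw [Submodule.map_smul'', Submodule.map_top, Submodule.range_mkQ]
          rw [h3] at h2
          obtain ⟨j, hj, hju⟩ := h2
          obtain ⟨v, -, hv⟩ := (Submodule.mem_smul_pointwise_iff_exists _ _ _).1
            ((Submodule.Quotient.eq _).1 hju.symm)
          exact ⟨v, by rwa [hv, sub_sub_cancel]⟩
        choose v hv using h1
        let N' : ℕ → ℕ := fun n => (Finset.range (n + 1)).sup N
        have hN' : ∀ n, N n ≤ N' n := fun n => Finset.le_sup (by simp)
        have hmono : ∀ {m n}, m ≤ n → N' m ≤ N' n := fun h =>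
          Finset.sup_mono (Finset.range_mono (by omega))
        have hu : ∀ {m n}, m ≤ n → u n - u m ∈ (J ^ m • ⊤ : Submodule R M) := fun {m n} h => by
          have := AdicCompletion.AdicCauchySequence.mk_eq_mk h u
          exact (Submodule.Quotient.eq _).1 this
        have hJ' : ∀ {m n}, m ≤ n → (J ^ n • ⊤ : Submodule R M) ≤ J ^ m • ⊤ := fun h =>
          Submodule.smul_mono_left (Ideal.pow_le_pow_right h)
        let w : AdicCompletion.AdicCauchySequence J M :=
          AdicCompletion.AdicCauchySequence.mk J M (fun n => v (N' n)) fun n => by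
            rw [SModEq.sub_mem]
            apply hN
            have h1 := hJ' (hN' n) (hv (N' n))
            have h2 := hJ' ((hN' n).trans (hmono n.le_succ)) (hv (N' (n + 1)))
            have h3 := hJ' (hN' n) (hu (hmono n.le_succ))
            have := add_mem (sub_mem h2 h1) (neg_mem h3)
            convert this using 1
            rw [smul_sub]
            abel
        refine (Submodule.mem_smul_pointwise_iff_exists _ _ _).2
          ⟨AdicCompletion.mk J M w, trivial, ?_⟩
        rw [← map_smul]
        ext n
        simp only [AdicCompletion.mk_apply_coe, AdicCompletion.AdicCauchySequence.smul_apply]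
        refine (Submodule.Quotient.eq _).2 ?_
        have h1 := hJ' ((hnN n).trans (hN' n)) (hv (N' n))
        have h2 := hu ((hnN n).trans (hN' n))
        have := sub_mem h2 h1
        convert this using 1
        change z • v (N' n) - u n = _
        abel
    let e : QuotSMulTop z (AdicCompletion J M) ≃ₗ[R] AdicCompletion J (QuotSMulTop z M) :=
      (Submodule.quotEquivOfEq _ _ hker).trans (f.quotKerEquivOfSurjective hf)
    rw [e.isWeaklyRegular_congr]
    refine ⟨hreg, ih (I := I ⊔ Ideal.span {z})
      (fun r hr x => smul_quotSMulTop_eq_zero_of_mem_sup hI z hr x)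
      (fun r hr => hzs r (by simp [hr])) ?_ h.2⟩
    rwa [sup_assoc, ← Ideal.ofList_cons]

end Completion

section DerivedComplete

lemma IsAdicComplete.isDerivedComplete {R M : Type*} [CommRing R] [AddCommGroup M] [Module R M]
    (J : Ideal R) [IsAdicComplete J M] {a : R} (ha : a ∈ J) : IsDerivedComplete a M := by
  refine isDerivedComplete_of (fun u hu k => ?_) fun v => ?_
  · have h : ∀ n k, u k = a ^ n • u (k + n) := by
      intro n
      induction n with
      | zero => simp
      | succ n ih =>
        intro k
        rw [ih, hu (k + n), smul_smul, ← pow_succ, add_assoc]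
    refine IsHausdorff.haus (I := J) inferInstance _ fun n => ?_
    rw [SModEq.zero, h n k]
    exact Submodule.smul_mem_smul (Ideal.pow_mem_pow ha n) trivial
  · let f : ℕ → ℕ → M := fun k n => ∑ i ∈ Finset.range n, a ^ i • v (k + i)
    have hf : ∀ k, ∃ L, ∀ n, f k n ≡ L [SMOD (J ^ n • ⊤ : Submodule R M)] := by
      intro k
      refine IsPrecomplete.prec inferInstance ?_
      intro m n hmn
      rw [SModEq.sub_mem, ← neg_sub]
      refine neg_mem ?_
      rw [← Finset.sum_Ico_eq_sub _ hmn]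
      refine Submodule.sum_mem _ fun i hi => ?_
      exact Submodule.smul_mem_smul
        (Ideal.pow_le_pow_right (Finset.mem_Ico.1 hi).1 (Ideal.pow_mem_pow ha i)) trivial
    choose L hL using hf
    refine ⟨L, fun k => ?_⟩
    rw [← sub_eq_zero]
    refine IsHausdorff.haus (I := J) inferInstance _ fun n => ?_
    have h1 := (SModEq.sub_mem.1 (hL k (n + 1)))
    have h1 := Submodule.smul_mono_left (N := ⊤) (Ideal.pow_le_pow_right n.le_succ) h1
    have h2 := Submodule.smul_mem _ a (SModEq.sub_mem.1 (hL (k + 1) n))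
    have h3 : f k (n + 1) = v k + a • f (k + 1) n := by
      simp only [f, Finset.sum_range_succ', Finset.smul_sum, smul_smul, ← pow_succ']
      rw [add_comm]
      congr 1
      · simp
      · exact Finset.sum_congr rfl fun i _ => by rw [add_right_comm, add_assoc]
    rw [SModEq.zero]
    have := sub_mem h2 h1
    rw [h3] at this
    convert this using 1
    rw [smul_sub]
    abel

lemma isDerivedComplete_algebraMap_iff {R : Type*} (A : Type*) {M : Type*} [CommRing R] [CommRing A]
    [Algebra R A] [AddCommGroup M] [Module R M] [Module A M] [IsScalarTower R A M] {a : R} :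
    IsDerivedComplete (algebraMap R A a) M ↔ IsDerivedComplete a M := by
  simp [IsDerivedComplete, algebraMap_smul]

end DerivedComplete

section Dimension

variable {R : Type*} [CommRing R]

lemma le_ringKrullDim_quotient_iff {I : Ideal R} {n : ℕ} :
    (n : WithBot ℕ∞) ≤ ringKrullDim (R ⧸ I) ↔
      ∃ l : LTSeries (PrimeSpectrum R), l.length = n ∧ I ≤ l.head.asIdeal := by
  rw [ringKrullDim_quotient, Order.le_krullDim_iff]
  constructor
  · rintro ⟨l, hl⟩
    exact ⟨l.map Subtype.val (fun _ _ h => h), hl, l.head.2⟩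
  · rintro ⟨l, hl, hI⟩
    refine ⟨⟨l.length, fun i => ⟨l i, ?_⟩, fun i => l.step i⟩, hl⟩
    exact hI.trans (l.monotone (Fin.zero_le i))

lemma ringKrullDim_quotient_antitone {I J : Ideal R} (h : I ≤ J) :
    ringKrullDim (R ⧸ J) ≤ ringKrullDim (R ⧸ I) :=
  ringKrullDim_le_of_surjective (Ideal.Quotient.factor h) (Ideal.Quotient.factor_surjective h)

lemma not_le_ringKrullDim_quotient_sup {I : Ideal R} {d : ℕ} {x : R}
    (hd : ringKrullDim (R ⧸ I) = d)
    (hx : ∀ q ∈ I.minimalPrimes, (d : WithBot ℕ∞) ≤ ringKrullDim (R ⧸ q) → x ∉ q) :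
    ¬ (d : WithBot ℕ∞) ≤ ringKrullDim (R ⧸ (I ⊔ Ideal.span {x})) := by
  rw [le_ringKrullDim_quotient_iff]
  rintro ⟨l, hl, hIl⟩
  obtain ⟨q, hq, hql⟩ := Ideal.exists_minimalPrimes_le (le_sup_left.trans hIl)
  have hxl : x ∈ l.head.asIdeal := hIl (le_sup_right (a := I) (Ideal.mem_span_singleton_self x))
  have hxq : x ∉ q := hx q hq (le_ringKrullDim_quotient_iff.2 ⟨l, hl, hql⟩)
  let q' : PrimeSpectrum R := ⟨q, hq.1.1⟩
  have hq' : q' < l.head := lt_of_le_of_ne hql fun h => hxq (by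
    rw [← h] at hxl; exact hxl)
  have : ((d + 1 : ℕ) : WithBot ℕ∞) ≤ ringKrullDim (R ⧸ I) :=
    le_ringKrullDim_quotient_iff.2 ⟨l.cons q' hq', by simp [hl], by simpa using hq.1.2⟩
  rw [hd] at this
  norm_cast at this
  omega

lemma ringKrullDim_quotient_le_sup_add_one [IsLocalRing R] [IsNoetherianRing R] (I : Ideal R)
    {x : R} (hx : x ∈ maximalIdeal R) :
    ringKrullDim (R ⧸ I) ≤ ringKrullDim (R ⧸ (I ⊔ Ideal.span {x})) + 1 := by
  let f : (R ⧸ (I ⊔ Ideal.span {x})) →ₗ[R] QuotSMulTop x (R ⧸ I) :=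
    Submodule.liftQ _ ((Submodule.mkQ _).comp (Submodule.mkQ I)) (by
      refine sup_le (fun r hr => ?_) ?_
      · have : I.mkQ r = 0 := (Submodule.Quotient.mk_eq_zero _).2 hr
        rw [LinearMap.mem_ker, LinearMap.comp_apply, this, map_zero]
      · rw [Ideal.span_le, Set.singleton_subset_iff]
        change Submodule.Quotient.mk _ = _
        rw [Submodule.Quotient.mk_eq_zero]
        refine (Submodule.mem_smul_pointwise_iff_exists _ _ _).2
          ⟨Submodule.Quotient.mk 1, trivial, ?_⟩
        rw [← Submodule.Quotient.mk_smul]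
        simp)
  have hf : Function.Surjective f := by
    rw [← LinearMap.range_eq_top, Submodule.range_liftQ, LinearMap.range_eq_top]
    exact (Submodule.mkQ_surjective _).comp (Submodule.mkQ_surjective _)
  have h1 := Module.supportDim_le_of_surjective f hf
  have h2 := Module.supportDim_le_supportDim_quotSMulTop_succ (M := R ⧸ I) hx
  rw [Module.supportDim_quotient_eq_ringKrullDim] at h1 h2
  exact h2.trans (by gcongr)

theorem exists_list_mem_minimalPrimes [IsLocalRing R] [IsNoetherianRing R] (p : Ideal R)
    [hp : p.IsPrime] (d : ℕ) :
    ∀ {I : Ideal R}, I ≤ p → ringKrullDim (R ⧸ I) = d →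
    ∃ (xs : List R) (e : ℕ), (∀ x ∈ xs, x ∈ p) ∧ e + xs.length = d ∧
      ringKrullDim (R ⧸ (I ⊔ Ideal.ofList xs)) = e ∧ ringKrullDim (R ⧸ p) = e ∧
      p ∈ (I ⊔ Ideal.ofList xs).minimalPrimes := by
  induction d using Nat.strong_induction_on with
  | _ d ih =>
    intro I hI hd
    by_cases h : ∃ q ∈ I.minimalPrimes, (d : WithBot ℕ∞) ≤ ringKrullDim (R ⧸ q) ∧ p ≤ q
    · obtain ⟨q, hq, hdq, hpq⟩ := h
      obtain rfl : p = q := le_antisymm hpq (hq.2 ⟨hp, hI⟩ hpq)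
      exact ⟨[], d, by simp, by simp, by rwa [Ideal.ofList_nil, sup_bot_eq],
        le_antisymm (hd ▸ ringKrullDim_quotient_antitone hI) hdq, by simpa using hq⟩
    · push Not at h
      have hf : {q ∈ I.minimalPrimes | (d : WithBot ℕ∞) ≤ ringKrullDim (R ⧸ q)}.Finite :=
        (I.finite_minimalPrimes_of_isNoetherianRing R).subset (Set.sep_subset _ _)
      have hne : ¬ ((p : Set R) ⊆ ⋃ q ∈ (hf.toFinset : Set (Ideal R)), ((q : Ideal R) : Set R)) := by
        rw [Ideal.subset_union_prime ⊥ ⊥ (fun q hq _ _ => (hf.mem_toFinset.1 hq).1.1.1)]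
        rintro ⟨q, hq, hle⟩
        exact h q (hf.mem_toFinset.1 hq).1 (hf.mem_toFinset.1 hq).2 hle
      obtain ⟨x, hx, hxn⟩ := Set.not_subset.1 hne
      have h1 := not_le_ringKrullDim_quotient_sup hd (x := x) fun q hq hdq hxq =>
        hxn (Set.mem_biUnion (hf.mem_toFinset.2 ⟨hq, hdq⟩) hxq)
      have h2 := ringKrullDim_quotient_le_sup_add_one I (le_maximalIdeal hp.ne_top hx)
      have hIx : I ⊔ Ideal.span {x} ≤ p :=
        sup_le hI ((Ideal.span_singleton_le_iff_mem _).2 hx)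
      have : Nontrivial (R ⧸ (I ⊔ Ideal.span {x})) :=
        Ideal.Quotient.nontrivial_iff.2 fun h => hp.ne_top (top_le_iff.1 (h ▸ hIx))
      have h3 := ringKrullDim_nonneg_of_nontrivial (R := R ⧸ (I ⊔ Ideal.span {x}))
      rw [hd] at h2
      obtain ⟨k, hk, hkd⟩ : ∃ k : ℕ, ringKrullDim (R ⧸ (I ⊔ Ideal.span {x})) = k ∧ k + 1 = d := by
        generalize ringKrullDim (R ⧸ (I ⊔ Ideal.span {x})) = D at h1 h2 h3
        induction D with
        | bot => simp at h3
        | coe D =>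
          induction D with
          | top => exact absurd le_top h1
          | coe D =>
            refine ⟨D, rfl, ?_⟩
            norm_cast at h1 h2
            omega
      obtain ⟨xs, e, hxs, hlen, he, hpe, hmin⟩ := ih k (by omega) hIx hk
      rw [sup_assoc, ← Ideal.ofList_cons] at he hmin
      refine ⟨x :: xs, e, ?_, ?_, he, hpe, hmin⟩
      · rintro y hy
        rcases List.mem_cons.1 hy with rfl | hy
        exacts [hx, hxs y hy]
      · simp only [List.length_cons]
        omega

/-- For a prime `p` of a Noetherian local ring `R` there is a system of parameters of `R`, written
as a concatenation `xs ++ ys`, such that `xs` lies in `p`, the prime `p` is minimal over `xs`, and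
`ys` has length `dim R ⧸ p`. -/
theorem IsLocalRing.exists_sop_append [IsLocalRing R] [IsNoetherianRing R] (p : Ideal R)
    [hp : p.IsPrime] {n : ℕ} (hn : ringKrullDim R = n) :
    ∃ xs ys : List R, (∀ x ∈ xs, x ∈ p) ∧ (∀ y ∈ ys, y ∈ maximalIdeal R) ∧
      xs.length + ys.length = n ∧ p ∈ (Ideal.ofList xs).minimalPrimes ∧
      ringKrullDim (R ⧸ p) = ys.length ∧
      maximalIdeal R ≤ (Ideal.ofList (xs ++ ys)).radical := by
  have hn' : ringKrullDim (R ⧸ (⊥ : Ideal R)) = n := by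
    rw [← hn]
    exact ringKrullDim_eq_of_ringEquiv (RingEquiv.quotientBot R)
  obtain ⟨xs, e, hxs, hlen, he, hpe, hmin⟩ := exists_list_mem_minimalPrimes p n bot_le hn'
  rw [bot_sup_eq] at he hmin
  obtain ⟨ys, e', hys, hlen', -, hme, hmin'⟩ := exists_list_mem_minimalPrimes (maximalIdeal R) e
    (hmin.1.2.trans (le_maximalIdeal hp.ne_top)) he
  rw [← Ideal.ofList_append] at hmin'
  have he' : e' = 0 := by
    have : ringKrullDim (R ⧸ maximalIdeal R) = 0 :=
      ringKrullDim_eq_zero_of_isField ((Ideal.Quotient.maximal_ideal_iff_isField_quotient _).1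
        inferInstance)
    rw [this] at hme
    exact_mod_cast hme.symm
  refine ⟨xs, ys, hxs, hys, by omega, hmin, ?_, ?_⟩
  · rw [hpe]
    congr 1
    omega
  · rw [Ideal.radical_eq_sInf]
    exact le_sInf fun q hq => hmin'.2 ⟨hq.2, hq.1⟩ (le_maximalIdeal hq.2.ne_top)

end Dimension

section Finiteness

variable {R : Type*} [CommRing R] {M N : Type*} [AddCommGroup M] [Module R M] [AddCommGroup N]
  [Module R N]

theorem IsHausdorff.of_forall_linearMap {ι : Type*} {F : ι → Type*} [∀ i, AddCommGroup (F i)]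
    [∀ i, Module R (F i)] (I : Ideal R) [∀ i, IsHausdorff I (F i)] (f : ∀ i, M →ₗ[R] F i)
    (hf : ∀ x, (∀ i, f i x = 0) → x = 0) : IsHausdorff I M where
  haus' x hx := hf x fun i => IsHausdorff.haus (I := I) inferInstance _ fun n => by
    have := hx n
    rw [SModEq.zero] at this ⊢
    have h2 := Submodule.mem_map_of_mem (f := f i) this
    rw [Submodule.map_smul''] at h2
    exact Submodule.smul_mono le_rfl le_top h2

theorem IsPrecomplete.pi_fin (I : Ideal R) [IsPrecomplete I R] (n : ℕ) :
    IsPrecomplete I (Fin n → R) where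
  prec' f hf := by
    have key : ∀ (k : ℕ) (x : Fin n → R),
        x ∈ (I ^ k • ⊤ : Submodule R (Fin n → R)) ↔ ∀ i, x i ∈ (I ^ k • ⊤ : Submodule R R) := by
      intro k x
      refine ⟨fun h i => ?_, fun h => ?_⟩
      · have h2 := Submodule.mem_map_of_mem (f := LinearMap.proj (R := R) (φ := fun _ => R) i) h
        rw [Submodule.map_smul''] at h2
        exact Submodule.smul_mono le_rfl le_top h2
      · rw [← LinearMap.sum_single_apply (φ := fun _ : Fin n => R) x]
        refine Submodule.sum_mem _ fun i _ => ?_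
        have h2 := Submodule.mem_map_of_mem
          (f := LinearMap.single R (fun _ : Fin n => R) i) (h i)
        rw [Submodule.map_smul''] at h2
        exact Submodule.smul_mono le_rfl le_top h2
    have : ∀ i, ∃ L : R, ∀ k, f k i ≡ L [SMOD (I ^ k • ⊤ : Submodule R R)] := fun i =>
      IsPrecomplete.prec ‹_› (f := fun k => f k i) fun {a b} hab => by
        have := hf hab
        rw [SModEq.sub_mem, key] at this
        rw [SModEq.sub_mem]
        exact this i
    choose L hL using this
    refine ⟨L, fun k => ?_⟩
    rw [SModEq.sub_mem, key]
    exact fun i => SModEq.sub_mem.1 (hL i k)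

theorem Module.Finite.of_isHausdorff_of_ker_le (I : Ideal R) [IsPrecomplete I R] [IsHausdorff I M]
    [IsNoetherian R N] (g : M →ₗ[R] N) (hg : g.ker ≤ I • ⊤) : Module.Finite R M := by
  obtain ⟨n, s, hs⟩ := Submodule.fg_iff_exists_fin_generating_family.1
    (IsNoetherian.noetherian (LinearMap.range g))
  have hs' : ∀ i, ∃ m, g m = s i := fun i => by
    have : s i ∈ LinearMap.range g := hs ▸ Submodule.subset_span ⟨i, rfl⟩
    exact this
  choose t ht using hs'
  have : IsPrecomplete I (Fin n → R) := IsPrecomplete.pi_fin I n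
  refine Module.Finite.of_surjective (Fintype.linearCombination R t)
    (surjective_of_mkQ_comp_surjective (I := I) fun y => ?_)
  obtain ⟨y, rfl⟩ := Submodule.mkQ_surjective _ y
  have hy : g y ∈ Submodule.span R (Set.range s) := hs ▸ ⟨y, rfl⟩
  obtain ⟨c, hc⟩ := (Submodule.mem_span_range_iff_exists_fun R).1 hy
  refine ⟨c, ?_⟩
  rw [LinearMap.comp_apply, ← sub_eq_zero, ← map_sub, Submodule.mkQ_apply,
    Submodule.Quotient.mk_eq_zero]
  refine hg ?_
  rw [LinearMap.mem_ker, map_sub, sub_eq_zero, ← hc, Fintype.linearCombination_apply, map_sum]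
  simp [ht]

end Finiteness

section CofiniteAlong
variable {R : Type u} [CommRing R] {M : Type v} [AddCommGroup M] [Module R M]

theorem Submodule.exists_maximal_notMem {u : M} (hu : u ≠ 0) :
    ∃ L : Submodule R M, u ∉ L ∧ ∀ L', L < L' → u ∈ L' := by
  obtain ⟨L, -, hL⟩ := zorn_le_nonempty₀ {L : Submodule R M | u ∉ L} (fun c hc hchain y hy => by
    refine ⟨sSup c, fun h => ?_, fun z hz => le_sSup hz⟩
    obtain ⟨L, hL, hu⟩ := (Submodule.mem_sSup_of_directed ⟨y, hy⟩ hchain.directedOn).1 h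
    exact hc hL hu) ⊥ (by simpa using hu)
  exact ⟨L, hL.prop, fun L' hL' => by_contra fun h => hL.not_gt h hL'⟩

theorem Submodule.fg_torsionBySet_pow [IsNoetherianRing R] {J : Ideal R}
    (h : (torsionBySet R M (J : Set R)).FG) (k : ℕ) :
    (torsionBySet R M ((J ^ k : Ideal R) : Set R)).FG := by
  induction k with
  | zero =>
    convert Submodule.fg_bot
    rw [eq_bot_iff]
    intro x hx
    simpa using (mem_torsionBySet_iff _ _).1 hx ⟨1, by simp⟩
  | succ k ih =>
    obtain ⟨n, s, hs⟩ := Submodule.fg_iff_exists_fin_generating_family.1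
      (IsNoetherian.noetherian J)
    let N := torsionBySet R M ((J ^ k : Ideal R) : Set R)
    have : Module.Finite R N := Module.Finite.iff_fg.2 ih
    have : Module.Finite R (torsionBySet R M (J : Set R)) := Module.Finite.iff_fg.2 h
    let N' := torsionBySet R M ((J ^ (k + 1) : Ideal R) : Set R)
    have hmem : ∀ i, s i ∈ J := fun i => hs ▸ Submodule.subset_span ⟨i, rfl⟩
    let f : Fin n → N' →ₗ[R] N := fun i => (((LinearMap.lsmul R M (s i)).domRestrict N').codRestrict
      N (fun x => (mem_torsionBySet_iff _ _).2 fun a => by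
        have := (mem_torsionBySet_iff _ _).1 x.2 ⟨a.1 * s i, by
          rw [pow_succ]; exact Ideal.mul_mem_mul a.2 (hmem i)⟩
        simpa [mul_smul] using this))
    have hf : ∀ i x, ((f i x : N) : M) = s i • (x : M) := fun _ _ => rfl
    let g : N' →ₗ[R] (Fin n → N) := LinearMap.pi f
    have hg : LinearMap.ker g ≤ (torsionBySet R M (J : Set R)).comap N'.subtype := by
      intro x hx
      rw [Submodule.mem_comap, mem_torsionBySet_iff]
      have hx' : ∀ i, s i • (x : M) = 0 := fun i => by
        rw [← hf]
        have := congrFun (LinearMap.mem_ker.1 hx) i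
        simpa [g] using congrArg Subtype.val this
      have hle : J ≤ LinearMap.ker (LinearMap.toSpanSingleton R M (x : M)) := by
        rw [← hs, Submodule.span_le]
        rintro _ ⟨i, rfl⟩
        exact hx' i
      exact fun a => hle a.2
    have : IsNoetherian R (LinearMap.ker g) := by
      refine isNoetherian_of_injective (((N'.subtype.comp (LinearMap.ker g).subtype).codRestrict
        (torsionBySet R M (J : Set R)) fun x => hg x.2)) ?_
      intro x y hxy
      have := congrArg Subtype.val hxy
      exact Subtype.ext (Subtype.ext this)
    have : IsNoetherian R N' := isNoetherian_of_range_eq_ker (LinearMap.ker g).subtype g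
      (by simp)
    exact Module.Finite.iff_fg.1 inferInstance

/-- For every ideal `I`, the submodule of `D` annihilated by `I` is finitely generated when `I`
and `zs` together generate an ideal primary to the maximal ideal, and vanishes when the dimension
of `R ⧸ I` is less than the length of `zs`. -/
structure CofiniteAlong (zs : List R) (D : Type v) [AddCommGroup D] [Module R D] [IsLocalRing R] :
    Prop where
  fg : ∀ I : Ideal R, maximalIdeal R ≤ (I ⊔ Ideal.ofList zs).radical →
    (Submodule.torsionBySet R D (I : Set R)).FG
  eq_bot : ∀ I : Ideal R, ringKrullDim (R ⧸ I) < zs.length →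
    Submodule.torsionBySet R D (I : Set R) = ⊥

theorem CofiniteAlong.exists_nil [IsLocalRing R] [IsNoetherianRing R] {x : M} (hx : x ≠ 0) :
    ∃ (D : Type v) (_ : AddCommGroup D) (_ : Module R D) (φ : M →ₗ[R] D),
      CofiniteAlong ([] : List R) D ∧ φ x ≠ 0 := by
  obtain ⟨L, hxL, hL⟩ := Submodule.exists_maximal_notMem (R := R) hx
  have hx0 : L.mkQ x ≠ 0 := by simpa using hxL
  refine ⟨M ⧸ L, inferInstance, inferInstance, L.mkQ, ⟨fun I hI => ?_, fun I hI => ?_⟩, hx0⟩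
  · have hsoc : (Submodule.torsionBySet R (M ⧸ L) (maximalIdeal R : Set R)).FG := by
      refine Submodule.FG.of_le (Submodule.fg_span_singleton (L.mkQ x)) ?_
      intro y hy
      by_cases hy0 : y = 0
      · simp [hy0]
      obtain ⟨y, rfl⟩ := L.mkQ_surjective y
      have hlt : L < L ⊔ Submodule.span R {y} := by
        refine lt_of_le_of_ne le_sup_left fun h => hy0 ?_
        simp only [Submodule.mkQ_apply, Submodule.Quotient.mk_eq_zero]
        rw [h]
        exact Submodule.mem_sup_right (Submodule.mem_span_singleton_self y)
      obtain ⟨l, hl, r, hr⟩ := Submodule.mem_sup.1 (hL _ hlt)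
      obtain ⟨hr1, hr2⟩ := hr
      obtain ⟨a, rfl⟩ := Submodule.mem_span_singleton.1 hr1
      have hxa : L.mkQ x = a • L.mkQ y := by
        rw [← hr2, map_add, map_smul]
        simp [hl]
      have ha : IsUnit a := by
        by_contra h
        exact hx0 (hxa.trans ((Submodule.mem_torsionBySet_iff _ _).1 hy ⟨a, h⟩))
      obtain ⟨b, rfl⟩ := ha
      refine Submodule.mem_span_singleton.2 ⟨(b⁻¹ : Rˣ), ?_⟩
      rw [hxa, smul_smul]
      simp
    rw [Ideal.ofList_nil, sup_bot_eq] at hI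
    obtain ⟨k, hk⟩ := Ideal.exists_pow_le_of_le_radical_of_fg hI (IsNoetherian.noetherian _)
    exact (Submodule.fg_torsionBySet_pow hsoc k).of_le
      (Submodule.torsionBySet_le_torsionBySet_of_subset hk)
  · have : I = ⊤ := by
      by_contra h
      have := Ideal.Quotient.nontrivial_iff.2 h
      exact absurd hI (not_lt.2 ringKrullDim_nonneg_of_nontrivial)
    rw [eq_bot_iff]
    intro y hy
    simpa using (Submodule.mem_torsionBySet_iff _ _).1 hy ⟨1, by simp [this]⟩

end CofiniteAlong

section TorsionFree
open Function RingTheory.Sequence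

theorem RingTheory.Sequence.IsWeaklyRegular.of_exact_of_iterate_eq_zero {R : Type*} [CommRing R]
    {rs : List R} : ∀ {K G : Type v} [AddCommGroup K] [Module R K] [AddCommGroup G] [Module R G]
    {f : K →ₗ[R] G} {g : G →ₗ[R] G}, Injective f → Exact f g → Surjective g →
    (∀ x, ∃ k, g^[k] x = 0) → IsWeaklyRegular K rs → IsWeaklyRegular G rs := by
  induction rs with
  | nil => intros; exact .nil R _
  | cons r rs ih =>
    intro K G _ _ _ _ f g hf hfg hg hnil hK
    rw [isWeaklyRegular_cons_iff] at hK ⊢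
    have hr : IsSMulRegular G r := by
      rw [isSMulRegular_iff_right_eq_zero_of_smul]
      intro x hx
      obtain ⟨k, hk⟩ := hnil x
      induction k generalizing x with
      | zero => exact hk
      | succ k ihk =>
        have := ihk (g x) (by rw [← map_smul, hx, map_zero]) hk
        obtain ⟨y, rfl⟩ := (hfg x).1 this
        rw [← map_smul, map_eq_zero_iff f hf] at hx
        rw [hK.1.right_eq_zero_of_smul hx, map_zero]
    refine ⟨hr, ih (QuotSMulTop.map_injective_of_exact_s7 hf hfg hr) (QuotSMulTop.map_exact r hfg hg)
      (QuotSMulTop.map_surjective r hg) (fun x => ?_) hK.2⟩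
    obtain ⟨x, rfl⟩ := Submodule.mkQ_surjective _ x
    obtain ⟨k, hk⟩ := hnil x
    refine ⟨k, ?_⟩
    have hs : Semiconj (r • (⊤ : Submodule R G)).mkQ g (QuotSMulTop.map r g) := fun x => rfl
    rw [← hs.iterate_right k x, hk, map_zero]

theorem IsSMulRegular.exists_bijective_smul {R M : Type u} [CommRing R] [AddCommGroup M]
    [Module R M] {z : R} (hz : IsSMulRegular M z) :
    ∃ (L : Type u) (_ : AddCommGroup L) (_ : Module R L) (ι : M →ₗ[R] L) (e : L ≃ₗ[R] L),
      Injective ι ∧ (∀ x : L, e x = z • x) ∧ ∀ x : L, ∃ k : ℕ, z ^ k • x ∈ LinearMap.range ι := by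
  let S := Submonoid.powers z
  let ι := LocalizedModule.mkLinearMap S M
  have hb := (Module.End.isUnit_iff _).1
    (IsLocalizedModule.map_units ι ⟨z, Submonoid.mem_powers z⟩)
  refine ⟨LocalizedModule S M, inferInstance, inferInstance, ι, LinearEquiv.ofBijective _ hb,
    ?_, fun x => rfl, fun x => ?_⟩
  · intro x y hxy
    obtain ⟨⟨_, k, rfl⟩, hc⟩ := IsLocalizedModule.exists_of_eq (S := S) hxy
    exact hz.pow k hc
  · obtain ⟨⟨y, ⟨_, k, rfl⟩⟩, h⟩ := IsLocalizedModule.surj S ι x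
    exact ⟨k, y, h.symm⟩

section Tate
variable {R : Type*} [CommRing R] (z : R) (E : Type v) [AddCommGroup E] [Module R E]

/-- The Tate module of `E` at `z`: the module of sequences `0 = e₀, e₁, e₂, …` in `E` such that
`z • eₖ₊₁ = eₖ`. -/
def tateModule : Submodule R (ℕ → E) where
  carrier := {e | e 0 = 0 ∧ ∀ k, z • e (k + 1) = e k}
  add_mem' := fun ha hb => ⟨by simp [ha.1, hb.1], fun k => by simp [ha.2, hb.2]⟩
  zero_mem' := ⟨rfl, fun k => by simp⟩
  smul_mem' := fun c e he => ⟨by simp [he.1], fun k => by simp [smul_comm z c, he.2]⟩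

variable {z E}

theorem tateModule.pow_smul_apply (e : tateModule z E) (k : ℕ) : z ^ k • e.1 k = 0 := by
  induction k with
  | zero => simp [e.2.1]
  | succ k ih => rw [pow_succ, mul_smul, e.2.2, ih]

theorem tateModule.eq_zero_of_smul_eq_zero {e : tateModule z E} (he : z • e = 0) : e = 0 := by
  ext k
  rw [← e.2.2]
  exact congrFun (congrArg Subtype.val he) (k + 1)

theorem tateModule.exists_smul_eq (e : tateModule z E) (h : e.1 1 = 0) : ∃ e', z • e' = e :=
  ⟨⟨fun k => e.1 (k + 1), h, fun k => e.2.2 (k + 1)⟩, by ext k; exact e.2.2 k⟩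

theorem CofiniteAlong.tateModule [IsLocalRing R] [IsNoetherianRing R]
    [IsPrecomplete (maximalIdeal R) R] {zs : List R} (hz : z ∈ maximalIdeal R)
    (h : CofiniteAlong zs E) : CofiniteAlong (z :: zs) (tateModule z E) where
  fg I hI := by
    set N := Submodule.torsionBySet R (_root_.tateModule z E) (I : Set R) with hN
    let F : ℕ → Submodule R E := fun k =>
      Submodule.torsionBySet R E ((I ⊔ Ideal.span {z ^ k} : Ideal R) : Set R)
    have hF : ∀ k, Module.Finite R (F k) := fun k => by
      refine Module.Finite.iff_fg.2 (h.fg _ (hI.trans ?_))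
      rw [← Ideal.radical_idem (_ ⊔ _ ⊔ _)]
      refine Ideal.radical_mono (sup_le ?_ ?_)
      · exact (le_sup_left.trans le_sup_left).trans Ideal.le_radical
      · rw [Ideal.ofList_cons]
        refine sup_le ?_ (le_sup_right.trans Ideal.le_radical)
        rw [Ideal.span_singleton_le_iff_mem]
        exact ⟨k, Ideal.mem_sup_left (Ideal.mem_sup_right (Ideal.mem_span_singleton_self _))⟩
    have hmem : ∀ (x : N) k, x.1.1 k ∈ F k := by
      intro x k
      rw [Submodule.mem_torsionBySet_iff]
      have hle : I ⊔ Ideal.span {z ^ k} ≤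
          LinearMap.ker (LinearMap.toSpanSingleton R E (x.1.1 k)) := by
        refine sup_le (fun a ha => ?_) ((Ideal.span_singleton_le_iff_mem _).2 ?_)
        · have := (Submodule.mem_torsionBySet_iff _ _).1 x.2 ⟨a, ha⟩
          exact congrFun (congrArg Subtype.val this) k
        · exact tateModule.pow_smul_apply x.1 k
      exact fun a => hle a.2
    let ev : ∀ k, N →ₗ[R] F k := fun k =>
      ((LinearMap.proj k).comp ((_root_.tateModule z E).subtype.comp N.subtype)).codRestrict (F k)
        fun x => hmem x k
    have hev : ∀ x k, (ev k x).1 = x.1.1 k := fun _ _ => rfl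
    have : IsHausdorff (maximalIdeal R) N := .of_forall_linearMap _ ev fun x hx => by
      ext k
      rw [← hev, hx]
      rfl
    refine Module.Finite.iff_fg.1 (Module.Finite.of_isHausdorff_of_ker_le (M := N)
      (maximalIdeal R) (ev 1) fun x hx => ?_)
    obtain ⟨e, he⟩ := tateModule.exists_smul_eq x.1 (by rw [← hev, LinearMap.mem_ker.1 hx]; rfl)
    have heN : e ∈ N := by
      rw [hN, Submodule.mem_torsionBySet_iff]
      intro a
      have := (Submodule.mem_torsionBySet_iff _ _).1 x.2 a
      rw [← he, smul_comm] at this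
      exact tateModule.eq_zero_of_smul_eq_zero this
    have : x = z • (⟨e, heN⟩ : N) := Subtype.ext he.symm
    rw [this]
    exact Submodule.smul_mem_smul hz trivial
  eq_bot I hI := by
    rw [eq_bot_iff]
    intro x hx
    by_contra hx0
    obtain ⟨q, hq, hle⟩ := exists_le_isAssociatedPrime_of_isNoetherianRing R x hx0
    obtain ⟨hqp, y, hy⟩ := isAssociatedPrime_iff.1 hq
    have hIq : I ≤ q := fun a ha => hle <| by
      rw [Submodule.mem_colon_singleton]
      exact (Submodule.mem_torsionBySet_iff _ _).1 hx ⟨a, ha⟩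
    have hqy : ∀ a ∈ q, a • y = 0 := fun a ha => by
      rw [hy, Submodule.mem_colon_singleton] at ha
      exact ha
    have hzq : z ∉ q := fun hzq => hqp.ne_top <| by
      rw [hy, Ideal.eq_top_iff_one, Submodule.mem_colon_singleton,
        tateModule.eq_zero_of_smul_eq_zero (hqy z hzq)]
      simp
    have hdim : ringKrullDim (R ⧸ (q ⊔ Ideal.span {z})) < zs.length := by
      have := Ideal.Quotient.nontrivial_iff.2 hqp.ne_top
      have h0 := ringKrullDim_nonneg_of_nontrivial (R := R ⧸ q)
      have h1 := (ringKrullDim_quotient_antitone hIq).trans_lt hI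
      obtain ⟨d, hd⟩ : ∃ d : ℕ, ringKrullDim (R ⧸ q) = d := by
        generalize ringKrullDim (R ⧸ q) = x at h0 h1
        induction x with
        | bot => simp at h0
        | coe x =>
          induction x with
          | top => exact absurd h1 (not_lt.2 le_top)
          | coe d => exact ⟨d, rfl⟩
      rw [hd] at h1
      have hdz : d ≤ zs.length := by
        rw [List.length_cons] at h1
        exact Nat.lt_succ_iff.1 (by exact_mod_cast h1)
      refine (not_le.1 (not_le_ringKrullDim_quotient_sup hd fun q' hq' _ => ?_)).trans_le
        (by exact_mod_cast hdz)
      rw [Ideal.minimalPrimes_eq_subsingleton_self] at hq'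
      rw [hq']
      exact hzq
    have hy0 : ∀ k, y.1 k = 0 := by
      intro k
      induction k with
      | zero => exact y.2.1
      | succ k ih =>
        have hle : q ⊔ Ideal.span {z} ≤
            LinearMap.ker (LinearMap.toSpanSingleton R E (y.1 (k + 1))) := by
          refine sup_le (fun a ha => ?_) ((Ideal.span_singleton_le_iff_mem _).2 ?_)
          · exact congrFun (congrArg Subtype.val (hqy a ha)) (k + 1)
          · exact (y.2.2 k).trans ih
        have : y.1 (k + 1) ∈ Submodule.torsionBySet R E ((q ⊔ Ideal.span {z} : Ideal R) : Set R) :=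
          (Submodule.mem_torsionBySet_iff _ _).2 fun a => hle a.2
        simpa [h.eq_bot _ hdim] using this
    refine hqp.ne_top ?_
    have : y = 0 := by ext k; exact hy0 k
    rw [hy, Ideal.eq_top_iff_one, Submodule.mem_colon_singleton, this]
    simp

end Tate

theorem RingTheory.Sequence.IsWeaklyRegular.exists_cofiniteAlong {R : Type u} [CommRing R]
    [IsLocalRing R] [IsNoetherianRing R] [IsPrecomplete (maximalIdeal R) R] {zs : List R} :
    ∀ {M : Type u} [AddCommGroup M] [Module R M] {x : M}, (∀ z ∈ zs, z ∈ maximalIdeal R) →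
      IsWeaklyRegular M zs → x ∉ (Ideal.ofList zs • ⊤ : Submodule R M) →
      ∃ (D : Type u) (_ : AddCommGroup D) (_ : Module R D) (φ : M →ₗ[R] D),
        CofiniteAlong zs D ∧ φ x ≠ 0 := by
  induction zs with
  | nil =>
    intro M _ _ x _ _ hx
    exact CofiniteAlong.exists_nil fun h => hx (h ▸ zero_mem _)
  | cons z zs ih =>
    intro M _ _ x hm hreg hx
    rw [isWeaklyRegular_cons_iff] at hreg
    obtain ⟨L, _, _, ι, e, hι, he, hL⟩ := hreg.1.exists_bijective_smul
    let π := (LinearMap.range ι).mkQ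
    have hπι : ∀ y, π (ι y) = 0 := fun y => by simp [π]
    have hze : ∀ y, z • e.symm y = y := fun y => by rw [← he, e.apply_symm_apply]
    have hf0 : z • (⊤ : Submodule R M) ≤ LinearMap.ker (π ∘ₗ e.symm.toLinearMap ∘ₗ ι) := by
      intro y hy
      obtain ⟨y, -, rfl⟩ := (Submodule.mem_smul_pointwise_iff_exists _ _ _).1 hy
      change π (e.symm (ι (z • y))) = 0
      rw [map_smul, map_smul, hze, hπι]
    let f : QuotSMulTop z M →ₗ[R] L ⧸ LinearMap.range ι := Submodule.liftQ _ _ hf0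
    have hfm : ∀ y, f ((z • (⊤ : Submodule R M)).mkQ y) = π (e.symm (ι y)) := fun _ => rfl
    let g : (L ⧸ LinearMap.range ι) →ₗ[R] L ⧸ LinearMap.range ι := LinearMap.lsmul R _ z
    have hf : Injective f := by
      rw [injective_iff_map_eq_zero]
      intro y hy
      obtain ⟨y, rfl⟩ := Submodule.mkQ_surjective _ y
      rw [hfm, Submodule.mkQ_apply, Submodule.Quotient.mk_eq_zero] at hy
      obtain ⟨y', hy'⟩ := hy
      rw [Submodule.mkQ_apply, Submodule.Quotient.mk_eq_zero,
        Submodule.mem_smul_pointwise_iff_exists]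
      refine ⟨y', trivial, hι ?_⟩
      rw [map_smul, hy', hze]
    have hfg : Exact f g := by
      intro y
      obtain ⟨y, rfl⟩ := Submodule.mkQ_surjective _ y
      constructor
      · intro hy
        rw [LinearMap.lsmul_apply, ← map_smul, Submodule.mkQ_apply,
          Submodule.Quotient.mk_eq_zero] at hy
        obtain ⟨y', hy'⟩ := hy
        refine ⟨(z • (⊤ : Submodule R M)).mkQ y', ?_⟩
        rw [hfm, hy', ← he, e.symm_apply_apply]
      · rintro ⟨y', hy'⟩
        obtain ⟨y', rfl⟩ := Submodule.mkQ_surjective _ y'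
        rw [← hy', hfm, LinearMap.lsmul_apply, ← map_smul, hze, hπι]
    have hg : Surjective g := by
      intro y
      obtain ⟨y, rfl⟩ := Submodule.mkQ_surjective _ y
      exact ⟨π (e.symm y), by rw [LinearMap.lsmul_apply, ← map_smul, hze]⟩
    have hnil : ∀ y, ∃ k, g^[k] y = 0 := by
      intro y
      obtain ⟨y, rfl⟩ := Submodule.mkQ_surjective _ y
      obtain ⟨k, hk⟩ := hL y
      refine ⟨k, ?_⟩
      have : ∀ k w, g^[k] w = z ^ k • w := fun k w => by
        induction k with
        | zero => simp
        | succ k ih => rw [iterate_succ_apply', ih, pow_succ', mul_smul]; rfl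
      rw [this, ← map_smul, Submodule.mkQ_apply, Submodule.Quotient.mk_eq_zero]
      exact hk
    have hGreg : IsWeaklyRegular (L ⧸ LinearMap.range ι) zs :=
      hreg.2.of_exact_of_iterate_eq_zero hf hfg hg hnil
    have hxG : π (e.symm (ι x)) ∉ (Ideal.ofList zs • ⊤ : Submodule R (L ⧸ LinearMap.range ι)) := by
      intro h
      rw [← hfm] at h
      have h2 := hGreg.mem_smul_top_of_exact hf hfg hg h
      refine hx ?_
      rw [← Submodule.range_mkQ (z • (⊤ : Submodule R M)), LinearMap.range_eq_map,
        ← Submodule.map_smul''] at h2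
      obtain ⟨y, hy, hyx⟩ := h2
      rw [← sub_eq_zero, ← map_sub, Submodule.mkQ_apply, Submodule.Quotient.mk_eq_zero] at hyx
      have : x = y - (y - x) := by abel
      rw [this, Ideal.ofList_cons, Submodule.sup_smul, Submodule.ideal_span_singleton_smul]
      exact sub_mem (Submodule.mem_sup_right hy) (Submodule.mem_sup_left hyx)
    obtain ⟨D, _, _, φ, hD, hφ⟩ := ih (fun z hz => hm z (List.mem_cons_of_mem _ hz)) hGreg hxG
    refine ⟨tateModule z D, inferInstance, inferInstance,
      (LinearMap.pi fun k => φ ∘ₗ π ∘ₗ (e.symm.toLinearMap ^ k) ∘ₗ ι).codRestrict _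
        fun y => ⟨?_, fun k => ?_⟩, hD.tateModule (hm z List.mem_cons_self), fun h => hφ ?_⟩
    · simp [hπι]
    · simp only [LinearMap.pi_apply, LinearMap.comp_apply, pow_succ', Module.End.mul_apply]
      rw [← map_smul, ← map_smul]
      erw [hze]
    · have : φ (π ((e.symm.toLinearMap ^ 1) (ι x))) = 0 := congrFun (congrArg Subtype.val h) 1
      simpa using this

/-- A module over a complete Noetherian local domain with a weakly regular system of parameters is
solid: every element outside `(zs) M` is detected by a map to a finite torsion-free module. -/
theorem RingTheory.Sequence.IsWeaklyRegular.exists_finite_torsionFree {R : Type u} [CommRing R]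
    [IsDomain R] [IsLocalRing R] [IsNoetherianRing R] [IsPrecomplete (maximalIdeal R) R]
    {zs : List R} {M : Type u} [AddCommGroup M] [Module R M] {x : M}
    (hzs : ∀ z ∈ zs, z ∈ maximalIdeal R) (hdim : ringKrullDim R = zs.length)
    (hrad : maximalIdeal R ≤ (Ideal.ofList zs).radical)
    (hreg : IsWeaklyRegular M zs) (hx : x ∉ (Ideal.ofList zs • ⊤ : Submodule R M)) :
    ∃ (D : Type u) (_ : AddCommGroup D) (_ : Module R D) (φ : M →ₗ[R] D),
      Module.Finite R D ∧ (∀ (r : R) (d : D), r • d = 0 → r = 0 ∨ d = 0) ∧ φ x ≠ 0 := by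
  obtain ⟨D, _, _, φ, hD, hφ⟩ := hreg.exists_cofiniteAlong hzs hx
  refine ⟨D, inferInstance, inferInstance, φ, ⟨?_⟩, fun r d hrd => ?_, hφ⟩
  · convert hD.fg ⊥ (by rwa [bot_sup_eq])
    rw [eq_comm, eq_top_iff]
    intro y _
    rw [Submodule.mem_torsionBySet_iff]
    rintro ⟨a, ha⟩
    simp [(Ideal.mem_bot.1 ha)]
  · by_contra! hne
    have h1 : ringKrullDim (R ⧸ Ideal.span {r}) < zs.length := by
      have h0 : ringKrullDim (R ⧸ (⊥ : Ideal R)) = zs.length := by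
        rw [← hdim]
        exact ringKrullDim_eq_of_ringEquiv (RingEquiv.quotientBot R)
      have := not_le.1 (not_le_ringKrullDim_quotient_sup (x := r) h0 fun q hq _ => ?_)
      · rwa [bot_sup_eq] at this
      · rw [Ideal.minimalPrimes_eq_subsingleton_self] at hq
        rw [hq]
        exact hne.1
    have h2 : d ∈ Submodule.torsionBySet R D (Ideal.span {r} : Set R) := by
      rw [Submodule.mem_torsionBySet_iff]
      rintro ⟨a, ha⟩
      obtain ⟨b, rfl⟩ := Ideal.mem_span_singleton'.1 ha
      rw [mul_smul, hrd, smul_zero]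
    rw [hD.eq_bot _ h1] at h2
    exact hne.2 h2

end TorsionFree

section Balanced
open RingTheory.Sequence

/-- The completion of a big Cohen-Macaulay algebra is balanced. -/
theorem RingTheory.Sequence.IsWeaklyRegular.exists_balanced {R : Type u} [CommRing R]
    [IsLocalRing R] [IsNoetherianRing R] {B : Type v} [CommRing B] [Algebra R B] {zs : List R}
    (hzs : ∀ z ∈ zs, z ∈ maximalIdeal R) (hrad : maximalIdeal R ≤ (Ideal.ofList zs).radical)
    (hreg : IsWeaklyRegular B zs) (hB : (maximalIdeal R).map (algebraMap R B) ≠ ⊤) :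
    ∃ (B' : Type v) (_ : CommRing B') (_ : Algebra R B'), Nonempty (B →ₐ[R] B') ∧
      (maximalIdeal R).map (algebraMap R B') ≠ ⊤ ∧
      ∀ ws : List R, ws.length = zs.length → (∀ w ∈ ws, w ∈ maximalIdeal R) →
        maximalIdeal R ≤ (Ideal.ofList ws).radical → IsWeaklyRegular B' ws := by
  set J := (maximalIdeal R).map (algebraMap R B) with hJ
  have hJfg : J.FG := Ideal.FG.map (IsNoetherian.noetherian _) _
  have hcomp : IsAdicComplete J (AdicCompletion J B) := AdicCompletion.isAdicComplete hJfg
  have hmap : ∀ z ∈ maximalIdeal R, algebraMap R B z ∈ J := fun z => Ideal.mem_map_of_mem _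
  have hreg' : IsWeaklyRegular (AdicCompletion J B) zs := by
    rw [← isWeaklyRegular_map_algebraMap_iff B] at hreg ⊢
    refine hreg.adicCompletion (I := ⊥) hJfg (by simp +contextual) ?_ ?_
    · intro r hr
      obtain ⟨z, hz, rfl⟩ := List.mem_map.1 hr
      exact hmap z (hzs z hz)
    · rw [bot_sup_eq, ← Ideal.map_ofList, hJ]
      exact (Ideal.map_mono hrad).trans (Ideal.map_radical_le _)
  refine ⟨AdicCompletion J B, inferInstance, inferInstance,
    ⟨IsScalarTower.toAlgHom R B (AdicCompletion J B)⟩, fun h => ?_, fun ws hlen hws hwrad => ?_⟩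
  · have h2 := congrArg (Ideal.map (AdicCompletion.evalOneₐ J : AdicCompletion J B →+* B ⧸ J)) h
    rw [Ideal.map_map, Ideal.map_top, IsScalarTower.algebraMap_eq R B (AdicCompletion J B),
      ← RingHom.comp_assoc, AlgHom.comp_algebraMap, ← Ideal.map_map, ← hJ,
      Ideal.Quotient.algebraMap_eq, Ideal.map_quotient_self] at h2
    have := Ideal.Quotient.nontrivial_iff.2 hB
    exact bot_ne_top h2
  · refine IsWeaklyRegular.exchange (I := ⊥) zs.length (by simp +contextual) rfl hlen hzs hws
      (by rwa [bot_sup_eq]) (by rwa [bot_sup_eq]) (fun a ha => ?_) hreg'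
    rw [← isDerivedComplete_algebraMap_iff B]
    exact IsAdicComplete.isDerivedComplete J (hmap a ha)

end Balanced

section AlmostRegular
open RingTheory.Sequence

theorem Ideal.exists_notMem_mul_pow_le {R : Type*} [CommRing R] [IsNoetherianRing R]
    {I P : Ideal R} (hP : P ∈ I.minimalPrimes) :
    ∃ s ∉ P, ∃ n, Ideal.span {s} * P ^ n ≤ I := by
  classical
  have hprime : P.IsPrime := hP.1.1
  have hfin := I.finite_minimalPrimes_of_isNoetherianRing R
  have : ¬ (hfin.toFinset.erase P).inf id ≤ P := by
    rw [hprime.inf_le']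
    rintro ⟨Q, hQ, hle⟩
    obtain ⟨hne, hQ⟩ := Finset.mem_erase.1 hQ
    rw [hfin.mem_toFinset] at hQ
    exact hne (le_antisymm hle (hP.2 hQ.1 hle))
  obtain ⟨s, hs, hsP⟩ := SetLike.not_le_iff_exists.1 this
  have hle : Ideal.span {s} * P ≤ I.radical := by
    rw [← Ideal.sInf_minimalPrimes]
    refine le_sInf fun Q hQ => ?_
    by_cases h : Q = P
    · exact h ▸ Ideal.mul_le_right
    · refine Ideal.mul_le_left.trans ((Ideal.span_singleton_le_iff_mem _).2 ?_)
      exact (Finset.inf_le (f := id) (Finset.mem_erase.2 ⟨h, hfin.mem_toFinset.2 hQ⟩)) hs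
  obtain ⟨n, hn⟩ := Ideal.exists_pow_le_of_le_radical_of_fg hle (IsNoetherian.noetherian _)
  rw [mul_pow, Ideal.span_singleton_pow] at hn
  exact ⟨s ^ n, fun h => hsP (hprime.mem_of_pow_mem n h), n, hn⟩

variable {A : Type*} [CommRing A]

/-- The sequence `rs` is weakly regular on the ring `A`, up to multiplication by `c`. -/
def IsAlmostRegular (c : A) (rs : List A) : Prop :=
  ∀ as b bs, rs = as ++ b :: bs → ∀ u, b * u ∈ Ideal.ofList as → c * u ∈ Ideal.ofList as

theorem isWeaklyRegular_self_iff (rs : List A) : IsWeaklyRegular A rs ↔ IsAlmostRegular 1 rs := by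
  rw [isWeaklyRegular_iff]
  have key : ∀ (I : Ideal A) (b : A), IsSMulRegular (A ⧸ (I • ⊤ : Submodule A A)) b ↔
      ∀ u, b * u ∈ I → 1 * u ∈ I := by
    intro I b
    rw [isSMulRegular_iff_right_eq_zero_of_smul, (Submodule.mkQ_surjective _).forall]
    refine forall_congr' fun u => ?_
    rw [← map_smul, Submodule.mkQ_apply, Submodule.mkQ_apply, Submodule.Quotient.mk_eq_zero,
      Submodule.Quotient.mk_eq_zero, smul_eq_mul, smul_eq_mul, Ideal.mul_top, one_mul]
  simp only [key]
  constructor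
  · rintro h as b bs rfl
    simpa using h as.length (by simp)
  · intro h i hi
    exact h _ _ (rs.drop (i + 1)) (by simp)

theorem Ideal.mem_ofList_pi_iff {ι : Type*} {rs : List (ι → A)} {x : ι → A} :
    x ∈ Ideal.ofList rs ↔ ∀ i, x i ∈ Ideal.ofList (rs.map fun r => r i) := by
  constructor
  · intro h i
    have := Ideal.mem_map_of_mem (Pi.evalRingHom (fun _ : ι => A) i) h
    rwa [Ideal.map_ofList] at this
  · induction rs generalizing x with
    | nil =>
      intro h
      rw [show x = 0 from funext fun i => by simpa using h i]
      exact zero_mem _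
    | cons r rs ih =>
      intro h
      simp only [List.map_cons, Ideal.ofList_cons, Submodule.mem_sup,
        Ideal.mem_span_singleton'] at h ⊢
      choose y hy z hz hyz using h
      choose a ha using hy
      exact ⟨_, ⟨a, rfl⟩, z, ih hz, funext fun i => by simp [ha, hyz]⟩

theorem IsAlmostRegular.pi {ι : Type*} {c : A} {rs : List (ι → A)}
    (h : ∀ i, IsAlmostRegular c (rs.map fun r => r i)) : IsAlmostRegular (fun _ => c) rs := by
  rintro as b bs rfl u hu
  rw [Ideal.mem_ofList_pi_iff] at hu ⊢
  exact fun i => h i _ (b i) (bs.map fun r => r i) (by simp) (u i) (hu i)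

theorem IsAlmostRegular.isWeaklyRegular_away {c : A} {rs : List A} (h : IsAlmostRegular c rs)
    (B : Type*) [CommRing B] [Algebra A B] [IsLocalization.Away c B] :
    IsWeaklyRegular B (rs.map (algebraMap A B)) := by
  rw [isWeaklyRegular_self_iff]
  rintro as b bs hrs x hx
  obtain ⟨as, rs', rfl, rfl, hrs'⟩ := List.map_eq_append_iff.1 hrs
  obtain ⟨b, bs, rfl, rfl, rfl⟩ := List.map_eq_cons_iff.1 hrs'
  obtain ⟨n, u, hu⟩ := IsLocalization.Away.surj c x
  have hc : ∀ n, IsUnit (algebraMap A B c ^ n) := fun n =>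
    (IsLocalization.Away.algebraMap_isUnit c).pow n
  rw [← Ideal.map_ofList] at hx ⊢
  have h1 : algebraMap A B (b * u) ∈ Ideal.map (algebraMap A B) (Ideal.ofList as) := by
    rw [map_mul, ← hu, ← mul_assoc]
    exact Ideal.mul_mem_right _ _ hx
  rw [IsLocalization.algebraMap_mem_map_algebraMap_iff (Submonoid.powers c)] at h1
  obtain ⟨_, ⟨k, rfl⟩, hk⟩ := h1
  have h2 := h as b bs rfl (c ^ k * u) (by convert hk using 1; ring)
  have h3 := Ideal.mem_map_of_mem (algebraMap A B) h2
  rw [map_mul, map_mul, ← hu, map_pow] at h3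
  have h4 : (algebraMap A B c ^ (1 + k + n)) * x ∈ Ideal.map (algebraMap A B) (Ideal.ofList as) := by
    convert h3 using 1
    ring
  rw [one_mul]
  exact (Ideal.unit_mul_mem_iff_mem _ (hc _)).1 h4

theorem IsAlmostRegular.quotient {I : Ideal A} {c : A} {xs ys : List A}
    (hle : Ideal.ofList xs ≤ I) (hc : ∀ a ∈ I, c * a ∈ Ideal.ofList xs)
    (h : IsWeaklyRegular A (xs ++ ys)) :
    IsAlmostRegular (Ideal.Quotient.mk I c) (ys.map (Ideal.Quotient.mk I)) := by
  rw [isWeaklyRegular_self_iff] at h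
  rintro as b bs hrs x hx
  obtain ⟨as, rs', rfl, rfl, hrs'⟩ := List.map_eq_append_iff.1 hrs
  obtain ⟨b, bs, rfl, rfl, rfl⟩ := List.map_eq_cons_iff.1 hrs'
  obtain ⟨x, rfl⟩ := Ideal.Quotient.mk_surjective x
  rw [← Ideal.map_ofList, ← map_mul, Ideal.mem_quotient_iff_mem_sup] at hx ⊢
  obtain ⟨y, hy, a, ha, hya⟩ := Submodule.mem_sup.1 hx
  have h1 := h (xs ++ as) b bs (by simp) (c * x) (by
    have : b * (c * x) = c * a + c * y := by
      rw [← mul_add, add_comm, hya]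
      ring
    rw [this, Ideal.ofList_append]
    exact add_mem (Submodule.mem_sup_left (hc a ha))
      (Submodule.mem_sup_right (Ideal.mul_mem_left _ _ hy)))
  rw [one_mul, Ideal.ofList_append] at h1
  exact sup_le (hle.trans le_sup_right) le_sup_left h1

end AlmostRegular

section Solid

/-- If `A` maps to a nonzero finite torsion-free module over the Noetherian local domain `R`, then
no element outside a prime ideal `P` of `R` becomes contained in `⋂ₑ (P + 𝔪 ^ e) A`. -/
theorem exists_algebraMap_notMem_map_sup {R : Type u} [CommRing R] [IsDomain R] [IsLocalRing R]
    [IsNoetherianRing R] {A : Type u} [CommRing A] [Algebra R A] {D : Type u} [AddCommGroup D]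
    [Module R D] [Module.Finite R D] (hD : ∀ (r : R) (d : D), r • d = 0 → r = 0 ∨ d = 0)
    (φ : A →ₗ[R] D) (hφ : φ 1 ≠ 0) (P : Ideal R) [hP : P.IsPrime] {a : R} (ha : a ∉ P) :
    ∃ e, algebraMap R A a ∉ (P ⊔ maximalIdeal R ^ e).map (algebraMap R A) := by
  by_contra! hmem
  let W := LinearMap.range φ
  have hle : LinearMap.range (LinearMap.lsmul R W a) ≤ P • ⊤ := by
    rintro _ ⟨⟨_, x, rfl⟩, rfl⟩
    rw [← Submodule.Quotient.mk_eq_zero]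
    refine IsHausdorff.haus (I := maximalIdeal R) inferInstance _ fun e => ?_
    rw [SModEq.zero]
    have h1 : a • x ∈ ((P ⊔ maximalIdeal R ^ e) • ⊤ : Submodule R A) := by
      rw [Ideal.smul_top_eq_map, Submodule.restrictScalars_mem, Algebra.smul_def]
      exact Ideal.mul_mem_right _ _ (hmem e)
    have h0 : (P • ⊤ : Submodule R (W ⧸ (P • ⊤ : Submodule R W))) ≤ ⊥ := by
      refine Submodule.smul_le.2 fun r hr y _ => ?_
      obtain ⟨y, rfl⟩ := Submodule.mkQ_surjective _ y
      rw [← map_smul, Submodule.mem_bot, Submodule.mkQ_apply, Submodule.Quotient.mk_eq_zero]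
      exact Submodule.smul_mem_smul hr trivial
    have h2 := Submodule.mem_map_of_mem (f := (P • (⊤ : Submodule R W)).mkQ ∘ₗ φ.rangeRestrict) h1
    rw [Submodule.map_smul''] at h2
    have h3 := Submodule.smul_mono le_rfl le_top h2
    rw [Submodule.sup_smul] at h3
    have h4 := sup_le (h0.trans bot_le) le_rfl h3
    rw [map_smul] at h4
    exact h4
  obtain ⟨p, hp, -, hcoeff, hpa⟩ :=
    LinearMap.exists_monic_and_natDegree_eq_and_coeff_mem_pow_and_aeval_eq_zero R _ P hle
  have h1 : p.eval a ∉ P := by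
    intro h
    have hpm : p.map (Ideal.Quotient.mk P) = Polynomial.X ^ p.natDegree := by
      ext k
      rw [Polynomial.coeff_map, Polynomial.coeff_X_pow]
      split_ifs with hk
      · rw [hk, hp.coeff_natDegree, map_one]
      · rcases lt_or_gt_of_ne hk with hk | hk
        · rw [Ideal.Quotient.eq_zero_iff_mem]
          exact Ideal.pow_le_self (by omega) (hcoeff k)
        · rw [Polynomial.coeff_eq_zero_of_natDegree_lt hk, map_zero]
    rw [← Ideal.Quotient.eq_zero_iff_mem, ← Polynomial.eval_map_apply, hpm, Polynomial.eval_pow,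
      Polynomial.eval_X, ← map_pow, Ideal.Quotient.eq_zero_iff_mem] at h
    exact ha (hP.mem_of_pow_mem _ h)
  have h2 : p.eval a • φ 1 = 0 := by
    have h3 : LinearMap.lsmul R W a = algebraMap R (Module.End R W) a := rfl
    rw [h3, Polynomial.aeval_algebraMap_apply] at hpa
    have := congrArg Subtype.val (LinearMap.congr_fun hpa ⟨φ 1, 1, rfl⟩)
    simpa using this
  rcases hD _ _ h2 with h | h
  · exact h1 (h ▸ zero_mem _)
  · exact hφ h

end Solid

section Reduction
open RingTheory.Sequence

/-- Reduction of a balanced big Cohen-Macaulay algebra modulo a prime ideal `P` of the base, in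
characteristic `p`. -/
theorem exists_ringHom_of_isWeaklyRegular {R : Type u} [CommRing R] [IsDomain R] [IsLocalRing R]
    [IsNoetherianRing R] [IsPrecomplete (maximalIdeal R) R] (p : ℕ) [hp : Fact p.Prime] [CharP R p]
    (P : Ideal R) [hP : P.IsPrime] {A : Type u} [CommRing A] [Algebra R A]
    (hA : (maximalIdeal R).map (algebraMap R A) ≠ ⊤) {n : ℕ} (hn : ringKrullDim R = n)
    (h : ∀ ws : List R, ws.length = n → (∀ w ∈ ws, w ∈ maximalIdeal R) →
      maximalIdeal R ≤ (Ideal.ofList ws).radical → IsWeaklyRegular A ws) :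
    ∃ ys : List R, (∀ y ∈ ys, y ∈ maximalIdeal R) ∧ ringKrullDim (R ⧸ P) = ys.length ∧
      maximalIdeal R ≤ (P ⊔ Ideal.ofList ys).radical ∧
      ∃ (B : Type u) (_ : CommRing B) (θ : A →+* B), (∀ r ∈ P, θ (algebraMap R A r) = 0) ∧
        (maximalIdeal R).map (θ.comp (algebraMap R A)) ≠ ⊤ ∧
        IsWeaklyRegular B (ys.map (θ.comp (algebraMap R A))) := by
  obtain ⟨xs, ys, hxs, hys, hlen, hmin, hdim, hrad⟩ := exists_sop_append P hn
  have hPm : P ≤ maximalIdeal R := le_maximalIdeal hP.ne_top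
  have hmem : ∀ z ∈ xs ++ ys, z ∈ maximalIdeal R := fun z hz =>
    (List.mem_append.1 hz).elim (fun hz => hPm (hxs z hz)) (hys z)
  have hlen' : (xs ++ ys).length = n := by rw [List.length_append, hlen]
  have hradP : maximalIdeal R ≤ (P ⊔ Ideal.ofList ys).radical := by
    refine hrad.trans (Ideal.radical_mono ?_)
    rw [Ideal.ofList_append]
    exact sup_le_sup_right hmin.1.2 _
  refine ⟨ys, hys, hdim, hradP, ?_⟩
  obtain ⟨c, hcP, N, hcN⟩ := Ideal.exists_notMem_mul_pow_le hmin
  let I : Ideal R := Ideal.ofList xs ⊔ P ^ (N + 1)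
  have hIP : I ≤ P := sup_le hmin.1.2 (Ideal.pow_le_self N.succ_ne_zero)
  have hcI : ∀ a ∈ I.map (algebraMap R A),
      algebraMap R A c * a ∈ Ideal.ofList (xs.map (algebraMap R A)) := by
    have hle : Ideal.span {c} * I ≤ Ideal.ofList xs := by
      rw [Ideal.mul_sup]
      exact sup_le Ideal.mul_le_right
        ((Ideal.mul_mono_right (Ideal.pow_le_pow_right N.le_succ)).trans hcN)
    have hle' := Ideal.map_mono (f := algebraMap R A) hle
    rw [Ideal.map_mul, Ideal.map_span, Set.image_singleton, Ideal.map_ofList] at hle'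
    exact fun a ha => hle' (Ideal.mul_mem_mul (Ideal.mem_span_singleton_self _) ha)
  obtain ⟨D, _, _, φ, hDfin, hD, hφ⟩ := (h _ hlen' hmem hrad).exists_finite_torsionFree (x := 1)
    hmem (by rw [hn, hlen']) hrad (fun h1 => hA <| by
      rw [Ideal.smul_top_eq_map, Submodule.restrictScalars_mem, ← Ideal.eq_top_iff_one] at h1
      exact top_le_iff.1 (h1 ▸ Ideal.map_mono (Ideal.span_le.2 hmem)))
  have : Nontrivial A := ⟨⟨1, 0, fun h1 => hφ (by rw [h1, map_zero])⟩⟩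
  have hAp : CharP A p := (CharP.charP_iff_prime_eq_zero hp.out).2 <| by
    rw [← map_natCast (algebraMap R A), CharP.cast_eq_zero, map_zero]
  let Q := A ⧸ I.map (algebraMap R A)
  let θ₀ : A →+* (ℕ → Q) := RingHom.pi fun e =>
    (Ideal.Quotient.mk (I.map (algebraMap R A))).comp (iterateFrobenius A p (e + N))
  have hθ₀ : ∀ a e, θ₀ a e = Ideal.Quotient.mk (I.map (algebraMap R A)) (a ^ p ^ (e + N)) :=
    fun a e => congrArg (Ideal.Quotient.mk _) (iterateFrobenius_def p (e + N) a)
  let γ : ℕ → Q := fun _ => Ideal.Quotient.mk _ (algebraMap R A c)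
  refine ⟨Localization.Away γ, inferInstance, (algebraMap _ (Localization.Away γ)).comp θ₀,
    fun r hr => ?_, fun htop => ?_, ?_⟩
  · have : θ₀ (algebraMap R A r) = 0 := by
      ext e
      rw [hθ₀, ← map_pow, Pi.zero_apply, Ideal.Quotient.eq_zero_iff_mem]
      refine Ideal.mem_map_of_mem _ (Ideal.mem_sup_right ?_)
      refine Ideal.pow_le_pow_right ?_ (Ideal.pow_mem_pow hr _)
      have := Nat.lt_pow_self (n := e + N) hp.out.one_lt
      omega
    rw [RingHom.comp_apply, this, map_zero]
  · rw [RingHom.comp_assoc, ← Ideal.map_map] at htop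
    have h1 : algebraMap (ℕ → Q) (Localization.Away γ) (1 : ℕ → Q) ∈
        Ideal.map (algebraMap (ℕ → Q) (Localization.Away γ))
          ((maximalIdeal R).map (θ₀.comp (algebraMap R A))) := by
      rw [htop]
      trivial
    rw [IsLocalization.algebraMap_mem_map_algebraMap_iff (Submonoid.powers γ)] at h1
    obtain ⟨_, ⟨k, rfl⟩, hk⟩ := h1
    rw [mul_one] at hk
    obtain ⟨e, he⟩ := exists_algebraMap_notMem_map_sup hD φ hφ P (a := c ^ k)
      (fun h => hcP (hP.mem_of_pow_mem _ h))
    refine he ?_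
    have h2 := Ideal.mem_map_of_mem (Pi.evalRingHom (fun _ => Q) e) hk
    rw [Ideal.map_map] at h2
    have h3 : (maximalIdeal R).map ((Pi.evalRingHom (fun _ => Q) e).comp
        (θ₀.comp (algebraMap R A))) ≤ ((maximalIdeal R ^ e).map (algebraMap R A)).map
          (Ideal.Quotient.mk (I.map (algebraMap R A))) := by
      refine Ideal.map_le_iff_le_comap.2 fun r hr => ?_
      rw [Ideal.mem_comap]
      change θ₀ (algebraMap R A r) e ∈ _
      rw [hθ₀, ← map_pow]
      refine Ideal.mem_map_of_mem _ (Ideal.mem_map_of_mem _ ?_)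
      refine Ideal.pow_le_pow_right ?_ (Ideal.pow_mem_pow hr _)
      have := Nat.lt_pow_self (n := e + N) hp.out.one_lt
      omega
    have h4 : (Pi.evalRingHom (fun _ => Q) e) (γ ^ k) =
        Ideal.Quotient.mk (I.map (algebraMap R A)) (algebraMap R A (c ^ k)) := by
      rw [map_pow, map_pow, map_pow]
      rfl
    have h5 := h3 h2
    rw [h4, Ideal.mem_quotient_iff_mem_sup] at h5
    rw [Ideal.map_sup]
    exact sup_le (le_sup_right (a := P.map (algebraMap R A)))
      ((Ideal.map_mono hIP).trans le_sup_left) h5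
  · rw [RingHom.comp_assoc, RingHom.coe_comp, ← List.map_map]
    refine IsAlmostRegular.isWeaklyRegular_away (c := γ) (IsAlmostRegular.pi fun e => ?_) _
    have h1 : (ys.map (θ₀.comp (algebraMap R A))).map (fun r => r e) =
        ((ys.map (· ^ p ^ (e + N))).map (algebraMap R A)).map (Ideal.Quotient.mk _) := by
      simp only [List.map_map]
      refine List.map_congr_left fun y _ => ?_
      change θ₀ (algebraMap R A y) e = _
      rw [hθ₀]
      simp
    rw [h1]
    have hq : p ^ (e + N) ≠ 0 := pow_ne_zero _ hp.out.ne_zero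
    refine IsAlmostRegular.quotient (xs := xs.map (algebraMap R A)) ?_ hcI ?_
    · rw [← Ideal.map_ofList]
      exact Ideal.map_mono le_sup_left
    · rw [← List.map_append, isWeaklyRegular_map_algebraMap_iff A A]
      refine h _ (by simpa using hlen) (fun w hw => ?_) ?_
      · rcases List.mem_append.1 hw with hw | hw
        · exact hPm (hxs w hw)
        · obtain ⟨y, hy, rfl⟩ := List.mem_map.1 hw
          exact Ideal.pow_mem_of_mem _ (hys y hy) _ (Nat.pos_of_ne_zero hq)
      · rw [Ideal.ofList_append] at hrad ⊢
        exact Ideal.le_radical_sup_ofList_map_pow hrad _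

end Reduction

end

/-- **Proposition (Dietz, Prop. 8.9 / `seedsurj`).** Let `R → S` be a surjective local
homomorphism of complete Noetherian local domains of positive prime characteristic `p`.
If `T` is a seed over `R`, then `T ⊗_R S` is a seed over `S`. -/
theorem seed_surjective_base_change
    (R : Type u) [CommRing R] [IsDomain R] [IsLocalRing R] [IsNoetherianRing R]
    [IsAdicComplete (maximalIdeal R) R]
    (S : Type u) [CommRing S] [IsDomain S] [IsLocalRing S] [IsNoetherianRing S]
    [IsAdicComplete (maximalIdeal S) S]
    (p : ℕ) [Fact p.Prime] [CharP R p] [CharP S p]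
    [Algebra R S] [IsLocalHom (algebraMap R S)]
    (hsurj : Function.Surjective (algebraMap R S))
    (T : Type u) [CommRing T] [Algebra R T] (hT : IsSeed R T) :
    IsSeed S (TensorProduct R S T) := by
  obtain ⟨B, _, _, ⟨⟨n, z, ⟨hzdim, hzm, hzrad⟩, hzreg⟩, hB⟩, ⟨f⟩⟩ := hT
  have hzl : ∀ w ∈ List.ofFn z, w ∈ maximalIdeal R := by
    intro w hw
    obtain ⟨i, rfl⟩ := List.mem_ofFn.1 hw
    exact hzm i
  have hspan : ∀ {A : Type u} [CommRing A] {k : ℕ} (x : Fin k → A),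
      Ideal.ofList (List.ofFn x) = Ideal.span (Set.range x) := by
    intro A _ k x
    rw [Ideal.ofList]
    congr 1
    ext a
    simp
  obtain ⟨A, _, _, ⟨g⟩, hA, hreg⟩ := hzreg.toIsWeaklyRegular.exists_balanced hzl
    (by rw [hspan, hzrad]) hB
  rw [List.length_ofFn] at hreg
  let P := RingHom.ker (algebraMap R S)
  have hP : P.IsPrime := RingHom.ker_isPrime _
  obtain ⟨ys, hys, hdim, hrad, C, _, θ, hθP, hθ, hθreg⟩ :=
    exists_ringHom_of_isWeaklyRegular p P hA hzdim.symm hreg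
  let σ : S →+* C := RingHom.liftOfSurjective (algebraMap R S) hsurj
    ⟨θ.comp (algebraMap R A), fun r hr => hθP r hr⟩
  have hσ : σ.comp (algebraMap R S) = θ.comp (algebraMap R A) :=
    RingHom.liftOfRightInverse_comp _ _ _ _
  let _ : Algebra S C := σ.toAlgebra
  let _ : Algebra R C := (θ.comp (algebraMap R A)).toAlgebra
  have : IsScalarTower R S C := .of_algebraMap_eq' hσ.symm
  let F : T →ₐ[R] C := (⟨θ, fun _ => rfl⟩ : A →ₐ[R] C).comp (g.comp f)
  have hm : (maximalIdeal R).map (algebraMap R S) = maximalIdeal S := by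
    refine le_antisymm (Ideal.map_le_iff_le_comap.2 fun r hr => ?_) fun s hs => ?_
    · exact fun hu => hr (isUnit_of_map_unit (algebraMap R S) r hu)
    · obtain ⟨r, rfl⟩ := hsurj s
      exact Ideal.mem_map_of_mem _ fun hu => hs (hu.map _)
  have hofn : List.ofFn (fun i => algebraMap R S (ys.get i)) = ys.map (algebraMap R S) := by
    exact List.map_ofFn.symm.trans (by rw [List.ofFn_get])
  have hys' : ∀ y ∈ ys.map (algebraMap R S), y ∈ maximalIdeal S := by
    intro y hy
    obtain ⟨r, hr, rfl⟩ := List.mem_map.1 hy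
    exact hm ▸ Ideal.mem_map_of_mem _ (hys r hr)
  have hC : (maximalIdeal S).map (algebraMap S C) ≠ ⊤ := by
    rw [← hm, Ideal.map_map]
    change Ideal.map (σ.comp _) _ ≠ _
    rwa [hσ]
  refine ⟨C, inferInstance, inferInstance, ⟨⟨ys.length, fun i => algebraMap R S (ys.get i),
    ⟨?_, fun i => ?_, ?_⟩, ?_⟩, ?_⟩, ⟨Algebra.TensorProduct.productLeftAlgHom (Algebra.ofId S C) F⟩⟩
  · rw [← hdim]
    exact ringKrullDim_eq_of_ringEquiv (RingHom.quotientKerEquivOfSurjective hsurj)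
  · exact hys' _ (List.mem_map_of_mem (List.get_mem _ _))
  · rw [← hspan, hofn]
    refine le_antisymm ((Ideal.IsPrime.radical_le_iff inferInstance).2 (Ideal.span_le.2 hys')) ?_
    have h1 := (Ideal.map_mono (f := algebraMap R S) hrad).trans (Ideal.map_radical_le _)
    rwa [hm, Ideal.map_sup, (Ideal.map_eq_bot_iff_le_ker _).2 le_rfl, bot_sup_eq,
      Ideal.map_ofList] at h1
  · rw [IsRegSeq, hofn]
    refine ⟨?_, fun h => hC ?_⟩
    · rw [← hσ, RingHom.coe_comp, ← List.map_map] at hθreg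
      exact (RingTheory.Sequence.isWeaklyRegular_map_algebraMap_iff C C _).1 hθreg
    · rw [eq_comm, Ideal.smul_top_eq_map] at h
      refine top_le_iff.1 (le_trans ?_ (Ideal.map_mono (Ideal.span_le.2 hys')))
      exact fun x _ => by
        have : x ∈ (⊤ : Submodule S C) := trivial
        rwa [← h] at this
  · exact hC
end
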